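/- arXiv:1801.06779 — 12 statements merged into one kernel-verified Lean document; each statement's English description precedes it below -/
import Mathlib

section
/- Let (p_n)_{n≥1} be a sequence of pairwise distinct prime numbers and (a_n)_{n≥1} a sequence of positive integers with p_n ∤ a_n for every n, and let M be the additive submonoid of ℚ generated by {a_n/p_n : n ≥ 1}. Then every x ∈ M can be written as x = N + Σ_n α_n·(a_n/p_n) where N is a nonnegative integer and (α_n) is a finitely supported sequence of integers with 0 ≤ α_n < p_n for every n, and this representation is unique. -/
open Finset in
/-- If a finite sum `∑ d n * a n / p n` with distinct prime denominators `p n` not dividing `a n`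
is an integer, then every `p k` divides `d k`. -/
theorem prime_dvd_coeff_of_sum_div_eq_int {ι : Type*}
    {p : ι → ℕ} (hp : ∀ n, Nat.Prime (p n)) (hpinj : Function.Injective p)
    {a : ι → ℕ} (hpa : ∀ n, ¬ p n ∣ a n) (s : Finset ι) (d : ι → ℤ) (z : ℤ)
    (h : ∑ n ∈ s, (d n : ℚ) * ((a n : ℚ) / (p n : ℚ)) = z) {k : ι} (hk : k ∈ s) :
    (p k : ℤ) ∣ d k := by
  classical
  have : Fact (p k).Prime := ⟨hp k⟩
  have hrest : padicNorm (p k) (∑ n ∈ s.erase k, (d n : ℚ) * ((a n : ℚ) / (p n : ℚ))) ≤ 1 := by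
    refine padicNorm.sum_le' (fun n hn => ?_) zero_le_one
    have : Fact (p n).Prime := ⟨hp n⟩
    have hne : p k ≠ p n := fun e => (ne_of_mem_erase hn) (hpinj e).symm
    rw [padicNorm.mul, padicNorm.div, padicNorm.padicNorm_of_prime_of_ne hne, div_one]
    exact mul_le_one₀ (padicNorm.of_int _) (padicNorm.nonneg _) (padicNorm.of_nat _)
  have hterm : padicNorm (p k) ((d k : ℚ) * ((a k : ℚ) / (p k : ℚ))) ≤ 1 := by
    rw [← add_sum_erase s _ hk] at h
    rw [eq_sub_of_add_eq h]
    exact padicNorm.sub.trans (max_le (padicNorm.of_int _) hrest)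
  rw [padicNorm.mul, padicNorm.div, (padicNorm.nat_eq_one_iff _).2 (hpa k),
    padicNorm.padicNorm_p_of_prime, one_div, inv_inv] at hterm
  rw [← padicNorm.int_lt_one_iff]
  have h1 : (1 : ℚ) < p k := by exact_mod_cast (hp k).one_lt
  by_contra hlt
  exact hterm.not_gt (h1.trans_le (le_mul_of_one_le_left (by positivity) (by linarith)))


/-- Let `(p n)` be pairwise distinct primes and `(a n)` positive integers with `p n ∤ a n`, and
let `M` be the additive submonoid of `ℚ` generated by the `a n / p n`.  Then every `x ∈ M` has a
unique representation `x = N + ∑ n, α n • (a n / p n)` with `N ∈ ℕ` and `(α n)` a finitely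
supported sequence of natural numbers satisfying `α n < p n` for all `n`. -/
theorem prime_reciprocal_unique_representation
    (p : ℕ → ℕ) (hp : ∀ n, Nat.Prime (p n)) (hpinj : Function.Injective p)
    (a : ℕ → ℕ) (ha : ∀ n, 0 < a n) (hpa : ∀ n, ¬ p n ∣ a n)
    (M : AddSubmonoid ℚ)
    (hM : M = AddSubmonoid.closure (Set.range fun n => (a n : ℚ) / (p n : ℚ)))
    (x : ℚ) (hx : x ∈ M) :
    ∃! Nα : ℕ × (ℕ →₀ ℕ),
      (∀ n, Nα.2 n < p n) ∧
        x = (Nα.1 : ℚ) + Nα.2.sum fun n c => (c : ℚ) * ((a n : ℚ) / (p n : ℚ)) := by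
  subst hM
  apply existsUnique_of_exists_of_unique
  · obtain ⟨c, rfl⟩ := AddSubmonoid.mem_closure_range_iff.1 hx
    refine ⟨⟨c.sum fun n m => m / p n * a n, Finsupp.onFinset c.support (fun n => c n % p n) ?_⟩,
      fun n => Nat.mod_lt _ (hp n).pos, ?_⟩
    · intro n hn
      rw [Finsupp.mem_support_iff]
      rintro h
      simp [h] at hn
    · rw [Finsupp.onFinset_sum _ (by simp)]
      simp only [Finsupp.sum, Nat.cast_sum, ← Finset.sum_add_distrib]
      refine Finset.sum_congr rfl fun n _ => ?_
      have hn : (p n : ℚ) ≠ 0 := by exact_mod_cast (hp n).ne_zero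
      have hdiv : (c n : ℚ) = p n * (c n / p n : ℕ) + (c n % p n : ℕ) := by
        exact_mod_cast (Nat.div_add_mod (c n) (p n)).symm
      rw [nsmul_eq_mul, hdiv]
      push_cast
      field_simp
  · rintro ⟨N, α⟩ ⟨N', β⟩ ⟨hα, hxα⟩ ⟨hβ, hxβ⟩
    dsimp only at hα hxα hβ hxβ
    have hαβ : α = β := by
      ext k
      by_cases hk : k ∈ α.support ∪ β.support
      · rw [Finsupp.sum_of_support_subset α Finset.subset_union_left _ (by simp)] at hxα
        rw [Finsupp.sum_of_support_subset β Finset.subset_union_right _ (by simp)] at hxβ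
        have hdvd := prime_dvd_coeff_of_sum_div_eq_int hp hpinj hpa (α.support ∪ β.support)
          (fun n => (α n : ℤ) - β n) ((N' : ℤ) - N)
          (by
            push_cast
            simp only [sub_mul, Finset.sum_sub_distrib]
            linarith) hk
        have hmod : β k ≡ α k [MOD p k] := Nat.modEq_iff_dvd.2 hdvd
        exact (hmod.eq_of_lt_of_lt (hβ k) (hα k)).symm
      · simp only [Finset.mem_union, Finsupp.mem_support_iff, not_or, not_not] at hk
        rw [hk.1, hk.2]
    subst hαβ
    have hN : (N : ℚ) = N' := by linarith
    rw [Nat.cast_injective hN]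
end

section
/- Every prime reciprocal Puiseux monoid M satisfies the ACCP: there is no sequence (q_n) of elements of M such that q_n − q_{n+1} ∈ M and q_{n+1} ≠ q_n for every n. -/
section ReciprocalExpansion

variable {p a : ℕ → ℕ}

/-- If an integer combination of the fractions `a i / p i` vanishes, then each `p j` divides its
coefficient. -/
theorem dvd_coeff_of_sum_mul_div_eq_zero (hp : ∀ n, Nat.Prime (p n))
    (hpinj : Function.Injective p) (hpa : ∀ n, ¬ p n ∣ a n) (s : Finset ℕ) (c : ℕ → ℤ)
    (h : ∑ i ∈ s, (c i : ℚ) * ((a i : ℚ) / (p i : ℚ)) = 0) {j : ℕ} (hj : j ∈ s) :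
    (p j : ℤ) ∣ c j := by
  have hp' : Prime (p j : ℤ) := Nat.prime_iff_prime_int.mp (hp j)
  have hz : ∑ i ∈ s, c i * (a i : ℤ) * ∏ k ∈ s.erase i, (p k : ℤ) = 0 := by
    have h2 := congrArg (fun x => x * ∏ k ∈ s, (p k : ℚ)) h
    simp only [zero_mul, Finset.sum_mul] at h2
    have h3 : ∑ i ∈ s, (c i : ℚ) * (a i : ℚ) * ∏ k ∈ s.erase i, (p k : ℚ) = 0 := by
      rw [← h2]
      refine Finset.sum_congr rfl fun i hi => ?_
      rw [← Finset.mul_prod_erase s _ hi]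
      have : (p i : ℚ) ≠ 0 := by exact_mod_cast (hp i).ne_zero
      field_simp
    exact_mod_cast h3
  have hdvd : (p j : ℤ) ∣ c j * (a j : ℤ) * ∏ k ∈ s.erase j, (p k : ℤ) := by
    rw [← Finset.add_sum_erase s _ hj] at hz
    rw [eq_neg_of_add_eq_zero_left hz, dvd_neg]
    refine Finset.dvd_sum fun i hi => Dvd.dvd.mul_left (Finset.dvd_prod_of_mem _ ?_) _
    exact Finset.mem_erase.mpr ⟨(Finset.ne_of_mem_erase hi).symm, hj⟩
  rcases hp'.dvd_or_dvd hdvd with h1 | h1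
  · rcases hp'.dvd_or_dvd h1 with h2 | h2
    · exact h2
    · exact absurd (Int.natCast_dvd_natCast.mp h2) (hpa j)
  · obtain ⟨k, hk, hjk⟩ := (hp'.dvd_finsetProd_iff _).mp h1
    have := (Nat.prime_dvd_prime_iff_eq (hp j) (hp k)).mp (Int.natCast_dvd_natCast.mp hjk)
    exact absurd (hpinj this).symm (Finset.ne_of_mem_erase hk)

/-- The elements of the monoid generated by the fractions `a i / p i` are their finite sums with
natural coefficients. -/
theorem exists_finsupp_sum_mul_div_eq {x : ℚ}
    (hx : x ∈ AddSubmonoid.closure (Set.range fun n => (a n : ℚ) / (p n : ℚ))) :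
    ∃ f : ℕ →₀ ℕ, f.sum (fun i n => (n : ℚ) * ((a i : ℚ) / (p i : ℚ))) = x := by
  obtain ⟨f, hf⟩ := AddSubmonoid.exists_finsupp_of_mem_closure_range _ _ hx
  exact ⟨f, by simpa only [nsmul_eq_mul] using hf.symm⟩

/-- Two finite combinations of the fractions `a i / p i` with the same value have congruent
coefficients. -/
theorem mod_eq_of_sum_mul_div_eq (hp : ∀ n, Nat.Prime (p n)) (hpinj : Function.Injective p)
    (hpa : ∀ n, ¬ p n ∣ a n) {f g : ℕ →₀ ℕ}
    (h : f.sum (fun i n => (n : ℚ) * ((a i : ℚ) / (p i : ℚ))) =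
      g.sum (fun i n => (n : ℚ) * ((a i : ℚ) / (p i : ℚ)))) (j : ℕ) :
    f j % p j = g j % p j := by
  have hs : ∀ e : ℕ →₀ ℕ, e.support ⊆ insert j (f.support ∪ g.support) →
      e.sum (fun i n => (n : ℚ) * ((a i : ℚ) / (p i : ℚ))) =
        ∑ i ∈ insert j (f.support ∪ g.support), (e i : ℚ) * ((a i : ℚ) / (p i : ℚ)) :=
    fun e he => Finsupp.sum_of_support_subset _ he _ (by simp)
  rw [hs f fun i hi => by simp_all, hs g fun i hi => by simp_all, ← sub_eq_zero,
    ← Finset.sum_sub_distrib] at h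
  have := dvd_coeff_of_sum_mul_div_eq_zero hp hpinj hpa _ (fun i => (g i : ℤ) - f i)
    (by rw [← neg_eq_zero, ← h, ← Finset.sum_neg_distrib]
        exact Finset.sum_congr rfl fun i _ => by push_cast; ring)
    (Finset.mem_insert_self j _)
  exact (Nat.modEq_iff_dvd).mpr this

/-- The integral part of the reduced expansion, followed by the sum of the reduced coefficients,
ordered lexicographically. -/
def expansionRank (p a : ℕ → ℕ) (f : ℕ →₀ ℕ) : ℕ ×ₗ ℕ :=
  toLex (f.sum fun i n => a i * (n / p i), f.sum fun i n => n % p i)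

theorem expansionRank_eq_of_sum_mul_div_eq (hp : ∀ n, Nat.Prime (p n))
    (hpinj : Function.Injective p) (hpa : ∀ n, ¬ p n ∣ a n) {f g : ℕ →₀ ℕ}
    (h : f.sum (fun i n => (n : ℚ) * ((a i : ℚ) / (p i : ℚ))) =
      g.sum (fun i n => (n : ℚ) * ((a i : ℚ) / (p i : ℚ)))) :
    expansionRank p a f = expansionRank p a g := by
  have hmod := mod_eq_of_sum_mul_div_eq hp hpinj hpa h
  have hf : f.support ⊆ f.support ∪ g.support := Finset.subset_union_left
  have hg : g.support ⊆ f.support ∪ g.support := Finset.subset_union_right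
  unfold expansionRank
  rw [Finsupp.sum_of_support_subset f hf _ (by simp),
    Finsupp.sum_of_support_subset g hg _ (by simp)] at h
  rw [Finsupp.sum_of_support_subset f hf _ (by simp),
    Finsupp.sum_of_support_subset g hg _ (by simp),
    Finsupp.sum_of_support_subset f hf _ (by simp),
    Finsupp.sum_of_support_subset g hg _ (by simp)]
  congr 2
  · have key : ∀ e : ℕ →₀ ℕ, ∀ i, (e i : ℚ) * ((a i : ℚ) / (p i : ℚ)) =
        ((a i * (e i / p i) : ℕ) : ℚ) + ((e i % p i : ℕ) : ℚ) * ((a i : ℚ) / (p i : ℚ)) := by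
      intro e i
      have hpi : (p i : ℚ) ≠ 0 := by exact_mod_cast (hp i).ne_zero
      have he : (e i : ℚ) = (p i : ℚ) * ((e i / p i : ℕ) : ℚ) + ((e i % p i : ℕ) : ℚ) := by
        exact_mod_cast (Nat.div_add_mod (e i) (p i)).symm
      rw [he, Nat.cast_mul]
      field_simp
    simp only [key, Finset.sum_add_distrib, hmod] at h
    exact_mod_cast add_right_cancel h
  · exact Finset.sum_congr rfl fun i _ => hmod i

theorem expansionRank_lt_add (ha : ∀ n, 0 < a n) (f : ℕ →₀ ℕ) {g : ℕ →₀ ℕ} (hg : g ≠ 0) :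
    expansionRank p a f < expansionRank p a (f + g) := by
  have hf : f.support ⊆ f.support ∪ g.support := Finset.subset_union_left
  have hfg : (f + g).support ⊆ f.support ∪ g.support := Finsupp.support_add
  unfold expansionRank
  rw [Finsupp.sum_of_support_subset f hf _ (by simp),
    Finsupp.sum_of_support_subset _ hfg _ (by simp),
    Finsupp.sum_of_support_subset f hf _ (by simp),
    Finsupp.sum_of_support_subset _ hfg _ (by simp), Prod.Lex.toLex_lt_toLex]
  have hle : ∀ i ∈ f.support ∪ g.support, a i * (f i / p i) ≤ a i * ((f + g) i / p i) :=
    fun i _ => Nat.mul_le_mul_left _ (Nat.div_le_div_right (by simp))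
  refine (Finset.sum_le_sum hle).lt_or_eq.imp_right fun heq => ⟨heq, ?_⟩
  have hmod : ∀ i ∈ f.support ∪ g.support, (f + g) i % p i = f i % p i + g i := by
    intro i hi
    have hdiv := Nat.eq_of_mul_eq_mul_left (ha i) ((Finset.sum_eq_sum_iff_of_le hle).mp heq i hi)
    have h1 := Nat.div_add_mod (f i) (p i)
    have h2 := Nat.div_add_mod ((f + g) i) (p i)
    rw [← hdiv] at h2
    rw [Finsupp.add_apply] at h2 ⊢
    omega
  obtain ⟨j, hj⟩ := Finsupp.support_nonempty_iff.mpr hg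
  refine Finset.sum_lt_sum (fun i hi => by rw [hmod i hi]; omega)
    ⟨j, Finset.mem_union_right _ hj, ?_⟩
  rw [hmod j (Finset.mem_union_right _ hj)]
  have := Finsupp.mem_support_iff.mp hj
  omega

end ReciprocalExpansion

/-- Every prime reciprocal Puiseux monoid satisfies the ACCP: there is no sequence `(q n)` of
elements of `M` with `q n - q (n+1) ∈ M` and `q (n+1) ≠ q n` for every `n`. -/
theorem prime_reciprocal_satisfies_ACCP (M : AddSubmonoid ℚ)
    (p : ℕ → ℕ) (hp : ∀ n, Nat.Prime (p n)) (hpinj : Function.Injective p)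
    (a : ℕ → ℕ) (ha : ∀ n, 0 < a n) (hpa : ∀ n, ¬ p n ∣ a n)
    (hM : M = AddSubmonoid.closure (Set.range fun n => (a n : ℚ) / (p n : ℚ))) :
    ¬ ∃ q : ℕ → ℚ, (∀ n, q n ∈ M) ∧ (∀ n, q n - q (n + 1) ∈ M) ∧ ∀ n, q (n + 1) ≠ q n := by
  rintro ⟨q, hq, hsub, hne⟩
  subst hM
  choose f hf using fun n => exists_finsupp_sum_mul_div_eq (hq n)
  choose g hg using fun n => exists_finsupp_sum_mul_div_eq (hsub n)
  have hdesc : ∀ n, expansionRank p a (f (n + 1)) < expansionRank p a (f n) := by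
    intro n
    have hg0 : g n ≠ 0 := by
      intro h0
      have := hg n
      rw [h0, Finsupp.sum_zero_index] at this
      exact hne n (sub_eq_zero.mp this.symm).symm
    rw [expansionRank_eq_of_sum_mul_div_eq (f := f n) (g := f (n + 1) + g n) hp hpinj hpa]
    · exact expansionRank_lt_add ha _ hg0
    · rw [Finsupp.sum_add_index' (by simp) (by intros; push_cast; ring), hf, hf, hg]
      ring
  obtain ⟨n, hn⟩ := WellFounded.not_rel_apply_succ (r := (· < ·))
    fun n => expansionRank p a (f n)
  exact hn (hdesc n)
end

section
/- Let F be a field and let M be a Puiseux monoid satisfying the ACCP. Then the Puiseux algebra F[M] satisfies the ACCP: every ascending chain of principal ideals (f_1) ⊆ (f_2) ⊆ ⋯ of F[M] stabilizes. -/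
/-- A Puiseux monoid: an additive submonoid of `ℚ` all of whose elements are nonnegative. -/
def IsPuiseuxMonoid (M : AddSubmonoid ℚ) : Prop := ∀ x ∈ M, 0 ≤ x

namespace AddMonoidAlgebra

variable {F A : Type*} [Field F] [AddCommMonoid A] [LinearOrder A] [OrderBot A]

lemma supDegree_id_mul [IsOrderedCancelAddMonoid A] {p q : AddMonoidAlgebra F A}
    (hp : p ≠ 0) (hq : q ≠ 0) :
    (p * q).supDegree id = p.supDegree id + q.supDegree id :=
  supDegree_mul Function.injective_id (fun _ _ => rfl)
    (mul_ne_zero ((leadingCoeff_ne_zero Function.injective_id).2 hp)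
      ((leadingCoeff_ne_zero Function.injective_id).2 hq)) hp hq

/-- If `0` is the least exponent, a nonzero element of degree `0` is a unit. -/
lemma isUnit_of_supDegree_id_eq_zero (hbot : (⊥ : A) = 0) {p : AddMonoidAlgebra F A} (hp : p ≠ 0)
    (hdeg : p.supDegree id = 0) : IsUnit p := by
  have hcoeff (a : A) (ha : a ≠ 0) : p.coeff a = 0 :=
    coeff_eq_zero_of_not_le_supDegree (D := id) fun h =>
      ha (hbot ▸ le_bot_iff.1 (h.trans (hdeg.trans hbot.symm).le))
  have hsingle : p = single 0 (p.coeff 0) := by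
    ext a
    by_cases ha : a = 0
    · simp [ha]
    · simp [hcoeff a ha, Ne.symm ha]
  have h0 : p.coeff 0 ≠ 0 := fun h => hp (by rw [hsingle, h, single_zero])
  refine IsUnit.of_mul_eq_one (single 0 (p.coeff 0)⁻¹) ?_
  rw [hsingle, single_mul_single]
  simp [h0, one_def]

end AddMonoidAlgebra

/-- In a Puiseux monoid, `0` is the least element. -/
abbrev IsPuiseuxMonoid.orderBot {M : AddSubmonoid ℚ} (hM : IsPuiseuxMonoid M) : OrderBot M where
  bot := 0
  bot_le x := hM x x.2

/-- Strict divisibility is well founded in the algebra of a Puiseux monoid with the ACCP. -/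
lemma IsPuiseuxMonoid.wellFounded_dvdNotUnit (F : Type*) [Field F] {M : AddSubmonoid ℚ}
    (hM : IsPuiseuxMonoid M)
    (hACCP : ¬ ∃ q : ℕ → ℚ, (∀ n, q n ∈ M) ∧ (∀ n, q n - q (n + 1) ∈ M) ∧
      ∀ n, q (n + 1) ≠ q n) :
    WellFounded (DvdNotUnit : AddMonoidAlgebra F M → AddMonoidAlgebra F M → Prop) := by
  let := hM.orderBot
  rw [wellFounded_iff_isEmpty_descending_chain]
  refine ⟨fun ⟨g, hg⟩ => hACCP ?_⟩
  have hg0 (n : ℕ) : g (n + 1) ≠ 0 := (hg n).1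
  choose x hx hgx using fun n => (hg (n + 1)).2
  have hx0 (n : ℕ) : x n ≠ 0 := fun h => hg0 n (by rw [hgx, h, mul_zero])
  have hdeg (n : ℕ) : (g (n + 1)).supDegree id =
      (g (n + 2)).supDegree id + (x n).supDegree id := by
    rw [hgx n, AddMonoidAlgebra.supDegree_id_mul (hg0 _) (hx0 n)]
  have hdeg' (n : ℕ) : (((g (n + 1)).supDegree id : M) : ℚ) =
      ((g (n + 2)).supDegree id : M) + ((x n).supDegree id : M) :=
    congrArg Subtype.val (hdeg n)
  refine ⟨fun n => ((g (n + 1)).supDegree id : M), fun n => Subtype.prop _, fun n => ?_,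
    fun n h => hx n ?_⟩
  · beta_reduce
    rw [hdeg' n, add_sub_cancel_left]
    exact Subtype.prop _
  · refine AddMonoidAlgebra.isUnit_of_supDegree_id_eq_zero rfl (hx0 n) (Subtype.ext ?_)
    beta_reduce at h
    rw [hdeg' n] at h
    exact left_eq_add.1 h

/-- If `F` is a field and `M` a Puiseux monoid satisfying the ACCP, then the Puiseux algebra
`F[M]` satisfies the ACCP: every ascending chain of principal ideals stabilizes. -/
theorem puiseux_algebra_satisfies_ACCP (F : Type*) [Field F]
    (M : AddSubmonoid ℚ) (hM : IsPuiseuxMonoid M)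
    (hACCP : ¬ ∃ q : ℕ → ℚ, (∀ n, q n ∈ M) ∧ (∀ n, q n - q (n + 1) ∈ M) ∧
      ∀ n, q (n + 1) ≠ q n)
    (f : ℕ → AddMonoidAlgebra F M)
    (hchain : ∀ n, Ideal.span {f n} ≤ Ideal.span {f (n + 1)}) :
    ∃ N, ∀ n, N ≤ n → Ideal.span {f n} = Ideal.span {f N} := by
  obtain ⟨_, ⟨N, rfl⟩, hN⟩ :=
    (hM.wellFounded_dvdNotUnit F hACCP).has_min (Set.range f) (Set.range_nonempty f)
  refine ⟨N, fun n hn => ?_⟩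
  have hle : Ideal.span {f N} ≤ Ideal.span {f n} := monotone_nat_of_le_succ hchain hn
  refine le_antisymm (Ideal.span_singleton_le_span_singleton.2 ?_) hle
  by_contra h
  exact hN _ ⟨n, rfl⟩
    (dvdNotUnit_of_dvd_of_not_dvd (Ideal.span_singleton_le_span_singleton.1 hle) h)
end

section
/- Let F be a field and let (P_n)_{n≥1} be a sequence of pairwise disjoint infinite sets of prime numbers; for each n let M_n be the additive submonoid of ℚ generated by {1/p : p ∈ P_n}. Then each Puiseux algebra F[M_n] is an atomic integral domain, no M_n is finitely generated, and for j ≠ k the algebras F[M_j] and F[M_k] are not isomorphic as F-algebras. -/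
open AddMonoidAlgebra

/-- On the Puiseux algebra of a monoid `M` of nonnegative rationals, the largest exponent is an
additive `M`-valued degree function, and nonzero elements of degree zero are units. -/
theorem AddMonoidAlgebra.exists_puiseux_degree (F : Type*) [Field F] {M : AddSubmonoid ℚ}
    (hM : ∀ x ∈ M, 0 ≤ x) :
    ∃ d : AddMonoidAlgebra F M → M,
      (∀ f g, f ≠ 0 → g ≠ 0 → d (f * g) = d f + d g) ∧
      (∀ f, f ≠ 0 → d f = 0 → IsUnit f) ∧
      ∀ m : M, d (single m 1) = m := by
  let : OrderBot M := { bot := 0, bot_le := fun x => hM x x.2 }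
  refine ⟨supDegree id, fun f g hf hg => ?_, fun f hf hd => ?_, fun m => ?_⟩
  · refine supDegree_mul Function.injective_id (fun _ _ => rfl) ?_ hf hg
    exact mul_ne_zero ((leadingCoeff_ne_zero Function.injective_id).2 hf)
      ((leadingCoeff_ne_zero Function.injective_id).2 hg)
  · have hsupp : ∀ m : M, m ≠ 0 → f.coeff m = 0 := fun m hm =>
      coeff_eq_zero_of_not_le_supDegree (D := id) fun hle => hm (le_antisymm (hle.trans hd.le) bot_le)
    have hf' : f = single 0 (f.coeff 0) := by
      ext m
      by_cases hm : m = 0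
      · simp [hm]
      · simp [hsupp m hm, Ne.symm hm]
    have h0 : f.coeff 0 ≠ 0 := fun h => hf (by rw [hf', h, single_zero])
    rw [hf']
    refine IsUnit.of_mul_eq_one (single 0 (f.coeff 0)⁻¹) ?_
    rw [single_mul_single, add_zero, mul_inv_cancel₀ h0, one_def]
  · exact supDegree_single_ne_zero m one_ne_zero

/-- If a monoid `M` of nonnegative rationals has a rank function which strictly increases on adding
a nonzero element, then strict divisibility in the Puiseux algebra of `M` is well-founded. -/
theorem AddMonoidAlgebra.wfDvdMonoid_of_rank (F : Type*) [Field F] {M : AddSubmonoid ℚ}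
    (hM : ∀ x ∈ M, 0 ≤ x) {r : M → ℕ ×ₗ ℕ} (hr : ∀ y z, z ≠ 0 → r y < r (y + z)) :
    WfDvdMonoid (AddMonoidAlgebra F M) := by
  obtain ⟨d, hmul, hunit, -⟩ := exists_puiseux_degree F hM
  have hlt : ∀ f g : AddMonoidAlgebra F M, g ≠ 0 → DvdNotUnit f g → r (d f) < r (d g) := by
    rintro f _ hg ⟨hf, h, hh, rfl⟩
    have h0 : h ≠ 0 := right_ne_zero_of_mul hg
    rw [hmul f h hf h0]
    exact hr _ _ fun hd => hh (hunit h h0 hd)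
  have hacc : ∀ f : AddMonoidAlgebra F M, f ≠ 0 → Acc DvdNotUnit f := fun f =>
    (InvImage.wf (fun f => r (d f)) wellFounded_lt).induction
      (C := fun f => f ≠ 0 → Acc DvdNotUnit f) f
      fun f ih hf => ⟨f, fun g hg => ih g (hlt g f hf hg) hg.1⟩
  refine ⟨⟨fun f => ⟨f, fun g hg => hacc g hg.1⟩⟩⟩

/-- The rational number `∑ c p / p` attached to a finitely supported family of multiplicities. -/
noncomputable def reciprocalSum (c : ℕ →₀ ℕ) : ℚ := c.sum fun p n => (n : ℚ) / p

theorem reciprocalSum_add (c d : ℕ →₀ ℕ) :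
    reciprocalSum (c + d) = reciprocalSum c + reciprocalSum d :=
  Finsupp.sum_add_index' (by simp) fun p m n => by push_cast; ring

theorem reciprocalSum_eq_sum {c : ℕ →₀ ℕ} {s : Finset ℕ} (h : c.support ⊆ s) :
    reciprocalSum c = ∑ p ∈ s, (c p : ℚ) / p :=
  Finsupp.sum_of_support_subset c h _ (by simp)

theorem exists_reciprocalSum_of_mem_closure {P : Set ℕ} {x : ℚ}
    (hx : x ∈ AddSubmonoid.closure {x : ℚ | ∃ p ∈ P, x = 1 / (p : ℚ)}) :
    ∃ c : ℕ →₀ ℕ, (∀ p ∈ c.support, p ∈ P) ∧ reciprocalSum c = x := by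
  classical
  induction hx using AddSubmonoid.closure_induction with
  | mem x hx =>
    obtain ⟨p, hp, rfl⟩ := hx
    refine ⟨Finsupp.single p 1, fun q hq => ?_, by simp [reciprocalSum]⟩
    rw [Finset.mem_singleton.1 (Finsupp.support_single_subset hq)]
    exact hp
  | zero => exact ⟨0, by simp, by simp [reciprocalSum]⟩
  | add x y _ _ hx hy =>
    obtain ⟨c, hc, rfl⟩ := hx
    obtain ⟨d, hd, rfl⟩ := hy
    refine ⟨c + d, fun p hp => ?_, reciprocalSum_add c d⟩
    exact (Finset.mem_union.1 (Finsupp.support_add hp)).elim (hc p) (hd p)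

theorem prod_mul_reciprocalSum {c : ℕ →₀ ℕ} {s : Finset ℕ} (hs : ∀ p ∈ s, p.Prime)
    (h : c.support ⊆ s) :
    ((∏ q ∈ s, q : ℕ) : ℚ) * reciprocalSum c = (∑ p ∈ s, c p * ∏ q ∈ s.erase p, q : ℕ) := by
  rw [reciprocalSum_eq_sum h, Finset.mul_sum, Nat.cast_sum]
  refine Finset.sum_congr rfl fun p hp => ?_
  have hp0 : (p : ℚ) ≠ 0 := Nat.cast_ne_zero.2 (hs p hp).ne_zero
  rw [← Finset.mul_prod_erase s _ hp]
  push_cast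
  field_simp

/-- The number `∑ c p / p` determines every multiplicity `c p` modulo `p`. -/
theorem mod_eq_of_reciprocalSum_eq {c d : ℕ →₀ ℕ} (hc : ∀ p ∈ c.support, p.Prime)
    (hd : ∀ p ∈ d.support, p.Prime) (h : reciprocalSum c = reciprocalSum d) (p : ℕ) :
    c p % p = d p % p := by
  classical
  by_cases hp : p ∈ c.support ∪ d.support
  swap
  · simp only [Finset.mem_union, Finsupp.mem_support_iff, not_or, not_not] at hp
    rw [hp.1, hp.2]
  set s := c.support ∪ d.support with hs
  have hprime : ∀ q ∈ s, q.Prime := fun q hq => (Finset.mem_union.1 hq).elim (hc q) (hd q)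
  have key : ∑ q ∈ s, c q * ∏ l ∈ s.erase q, l = ∑ q ∈ s, d q * ∏ l ∈ s.erase q, l := by
    have h1 := prod_mul_reciprocalSum hprime (Finset.subset_union_left : c.support ⊆ s)
    rw [h, prod_mul_reciprocalSum hprime (Finset.subset_union_right : d.support ⊆ s)] at h1
    exact_mod_cast h1.symm
  have hmod : ∀ e : ℕ →₀ ℕ, ∑ q ∈ s, e q * ∏ l ∈ s.erase q, l
      ≡ e p * ∏ l ∈ s.erase p, l [MOD p] := fun e => by
    rw [← Finset.add_sum_erase s _ hp]
    refine Nat.ModEq.trans (Nat.ModEq.add_left _ (Nat.modEq_zero_iff_dvd.2 ?_)) (by simp; rfl)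
    refine Finset.dvd_sum fun q hq => Dvd.dvd.mul_left (Finset.dvd_prod_of_mem _ ?_) _
    exact Finset.mem_erase.2 ⟨(Finset.ne_of_mem_erase hq).symm, hp⟩
  have hcop : Nat.Coprime p (∏ l ∈ s.erase p, l) := Nat.Coprime.prod_right fun q hq =>
    (Nat.coprime_primes (hprime p hp) (hprime q (Finset.mem_of_mem_erase hq))).2
      (Finset.ne_of_mem_erase hq).symm
  exact Nat.ModEq.cancel_right_of_coprime hcop ((hmod c).symm.trans (key ▸ hmod d))

/-- The integral part of the normal form of `∑ c p / p`, paired with the sum of its digits. -/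
noncomputable def reciprocalRank (c : ℕ →₀ ℕ) : ℕ ×ₗ ℕ :=
  toLex (c.sum fun p n => n / p, c.sum fun p n => n % p)

theorem reciprocalRank_eq_sum {c : ℕ →₀ ℕ} {s : Finset ℕ} (h : c.support ⊆ s) :
    reciprocalRank c = toLex (∑ p ∈ s, c p / p, ∑ p ∈ s, c p % p) := by
  rw [reciprocalRank, Finsupp.sum_of_support_subset c h _ (by simp),
    Finsupp.sum_of_support_subset c h _ (by simp)]

theorem reciprocalRank_congr {c d : ℕ →₀ ℕ} (hc : ∀ p ∈ c.support, p.Prime)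
    (hd : ∀ p ∈ d.support, p.Prime) (h : reciprocalSum c = reciprocalSum d) :
    reciprocalRank c = reciprocalRank d := by
  classical
  have hmod := mod_eq_of_reciprocalSum_eq hc hd h
  set s := c.support ∪ d.support with hs
  have hprime : ∀ q ∈ s, q.Prime := fun q hq => (Finset.mem_union.1 hq).elim (hc q) (hd q)
  have hsplit : ∀ e : ℕ →₀ ℕ, ∑ p ∈ s, (e p : ℚ) / p =
      (∑ p ∈ s, e p / p : ℕ) + ∑ p ∈ s, ((e p % p : ℕ) : ℚ) / p := fun e => by
    rw [Nat.cast_sum, ← Finset.sum_add_distrib]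
    refine Finset.sum_congr rfl fun p hp => ?_
    have hp0 : (p : ℚ) ≠ 0 := Nat.cast_ne_zero.2 (hprime p hp).ne_zero
    have := congrArg (Nat.cast : ℕ → ℚ) (Nat.div_add_mod (e p) p)
    rw [Nat.cast_add, Nat.cast_mul] at this
    rw [← this, add_div, mul_div_cancel_left₀ _ hp0]
  rw [reciprocalSum_eq_sum (Finset.subset_union_left : c.support ⊆ s),
    reciprocalSum_eq_sum (Finset.subset_union_right : d.support ⊆ s), hsplit, hsplit] at h
  simp only [hmod, add_left_inj, Nat.cast_inj] at h
  rw [reciprocalRank_eq_sum (Finset.subset_union_left : c.support ⊆ s),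
    reciprocalRank_eq_sum (Finset.subset_union_right : d.support ⊆ s), h]
  congr 2
  exact Finset.sum_congr rfl fun p _ => hmod p

theorem reciprocalRank_lt_add {c d : ℕ →₀ ℕ} (hc : ∀ p ∈ c.support, p.Prime)
    (hd : ∀ p ∈ d.support, p.Prime) (h0 : d ≠ 0) :
    reciprocalRank c < reciprocalRank (c + d) := by
  classical
  set s := c.support ∪ d.support with hs
  have hprime : ∀ q ∈ s, q.Prime := fun q hq => (Finset.mem_union.1 hq).elim (hc q) (hd q)
  rw [reciprocalRank_eq_sum (Finset.subset_union_left : c.support ⊆ s),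
    reciprocalRank_eq_sum (Finsupp.support_add : (c + d).support ⊆ s), Prod.Lex.toLex_lt_toLex]
  have hle : ∀ p ∈ s, c p / p ≤ (c + d) p / p := fun p _ =>
    Nat.div_le_div_right (Nat.le_add_right _ _)
  rcases (Finset.sum_le_sum hle).lt_or_eq with hlt | heq
  · exact Or.inl hlt
  refine Or.inr ⟨heq, ?_⟩
  have hdigit : ∀ p ∈ s, (c + d) p % p = c p % p + d p := fun p hp => by
    have h1 := (Finset.sum_eq_sum_iff_of_le hle).1 heq p hp
    have h2 := Nat.div_add_mod (c p) p
    have h3 := Nat.div_add_mod ((c + d) p) p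
    rw [← h1] at h3
    rw [Finsupp.add_apply] at h3 ⊢
    omega
  obtain ⟨q, hq⟩ := Finsupp.support_nonempty_iff.2 h0
  refine Finset.sum_lt_sum (fun p hp => (hdigit p hp).ge.trans' (Nat.le_add_right _ _))
    ⟨q, Finset.mem_union_right _ hq, ?_⟩
  rw [hdigit q (Finset.mem_union_right _ hq)]
  exact Nat.lt_add_of_pos_right (Nat.pos_of_ne_zero (Finsupp.mem_support_iff.1 hq))

theorem exists_rank_closure_reciprocals {P : Set ℕ} (hP : ∀ p ∈ P, p.Prime) {M : AddSubmonoid ℚ}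
    (hM : M = AddSubmonoid.closure {x : ℚ | ∃ p ∈ P, x = 1 / (p : ℚ)}) :
    ∃ r : M → ℕ ×ₗ ℕ, ∀ y z, z ≠ 0 → r y < r (y + z) := by
  choose c hc hcsum using fun x : M => exists_reciprocalSum_of_mem_closure (hM.le x.2)
  have hprime : ∀ x, ∀ p ∈ (c x).support, p.Prime := fun x p hp => hP p (hc x p hp)
  refine ⟨fun x => reciprocalRank (c x), fun y z hz => ?_⟩
  have h0 : c z ≠ 0 := fun h => hz (Subtype.ext (by rw [← hcsum z, h]; simp [reciprocalSum]))
  refine (reciprocalRank_lt_add (hprime y) (hprime z) h0).trans_eq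
    (reciprocalRank_congr (fun p hp => ?_) (hprime _) ?_)
  · exact (Finset.mem_union.1 (Finsupp.support_add hp)).elim (hprime y p) (hprime z p)
  · rw [reciprocalSum_add, hcsum, hcsum, hcsum, AddSubmonoid.coe_add]

theorem Rat.not_dvd_den_of_mem_closure {p : ℕ} (hp : p.Prime) {S : Set ℚ}
    (hS : ∀ x ∈ S, ¬ p ∣ x.den) {x : ℚ} (hx : x ∈ AddSubmonoid.closure S) : ¬ p ∣ x.den := by
  induction hx using AddSubmonoid.closure_induction with
  | mem x hx => exact hS x hx
  | zero => simpa using hp.one_lt.ne'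
  | add x y _ _ hx hy =>
    exact fun h => (hp.dvd_mul.1 (h.trans (Rat.add_den_dvd x y))).elim hx hy

theorem Rat.den_one_div_prime {p : ℕ} (hp : p.Prime) : (1 / (p : ℚ)).den = p := by
  rw [one_div, Rat.inv_natCast_den_of_pos hp.pos]

theorem not_fg_closure_reciprocals {P : Set ℕ} (hP : ∀ p ∈ P, p.Prime) (hinf : P.Infinite) :
    ¬ (AddSubmonoid.closure {x : ℚ | ∃ p ∈ P, x = 1 / (p : ℚ)}).FG := by
  rintro ⟨S, hS⟩
  obtain ⟨p, hpP, hlt⟩ := hinf.exists_gt (∏ x ∈ S, x.den)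
  have hp := hP p hpP
  refine Rat.not_dvd_den_of_mem_closure hp (S := S) (x := 1 / (p : ℚ)) (fun x hx h => ?_) ?_
    (Rat.den_one_div_prime hp).symm.dvd
  · exact hlt.not_ge ((Nat.le_of_dvd x.den_pos h).trans
      (Nat.le_of_dvd (Finset.prod_pos fun y _ => y.den_pos) (Finset.dvd_prod_of_mem _ hx)))
  · rw [hS]
    exact AddSubmonoid.subset_closure ⟨p, hpP, rfl⟩

theorem nonneg_of_mem_closure_reciprocals {P : Set ℕ} {x : ℚ}
    (hx : x ∈ AddSubmonoid.closure {x : ℚ | ∃ p ∈ P, x = 1 / (p : ℚ)}) : 0 ≤ x := by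
  induction hx using AddSubmonoid.closure_induction with
  | mem x hx =>
    obtain ⟨p, -, rfl⟩ := hx
    positivity
  | zero => exact le_rfl
  | add x y _ _ hx hy => exact add_nonneg hx hy

/-- A rational number which is divisible, for infinitely many primes `p`, by `p` in the ring of
`p`-integral rationals is zero. -/
theorem Rat.eq_zero_of_infinite_prime_dvd {Q : Set ℕ} (hQ : ∀ p ∈ Q, p.Prime) (hinf : Q.Infinite)
    {x : ℚ} (h : ∀ p ∈ Q, ∃ y : ℚ, ¬ p ∣ y.den ∧ x = p * y) : x = 0 := by
  by_contra hx
  obtain ⟨p, hpQ, hlt⟩ := hinf.exists_gt x.num.natAbs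
  obtain ⟨y, hy, hxy⟩ := h p hpQ
  have heq : x.num * y.den = p * (y.num * x.den) := by
    have hx' := Rat.num_div_den x
    have hy' := Rat.num_div_den y
    have hxd : (x.den : ℚ) ≠ 0 := Nat.cast_ne_zero.2 x.den_nz
    have hyd : (y.den : ℚ) ≠ 0 := Nat.cast_ne_zero.2 y.den_nz
    rw [← hx', ← hy'] at hxy
    field_simp at hxy
    rw [mul_comm (y.num : ℤ), ← mul_assoc, mul_comm (p : ℤ)]
    exact_mod_cast hxy
  have hdvd : (p : ℤ) ∣ x.num * y.den := ⟨_, heq⟩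
  rcases (Nat.prime_iff_prime_int.1 (hQ p hpQ)).dvd_or_dvd hdvd with h1 | h1
  · exact hlt.not_ge (Nat.le_of_dvd (Int.natAbs_pos.2 (Rat.num_ne_zero.2 hx))
      (Int.natCast_dvd.1 h1))
  · exact hy (Int.natCast_dvd_natCast.1 h1)

/-- If `P` is an infinite set of primes disjoint from `Q`, there is no multiplicative isomorphism
between the Puiseux algebras of the monoids generated by the reciprocals of `P` and of `Q`. -/
theorem isEmpty_mulEquiv_of_disjoint (F : Type*) [Field F] {P Q : Set ℕ}
    (hP : ∀ p ∈ P, p.Prime) (hinf : P.Infinite) (hQ : ∀ p ∈ Q, p.Prime) (hdisj : Disjoint P Q)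
    {M N : AddSubmonoid ℚ} (hM : M = AddSubmonoid.closure {x : ℚ | ∃ p ∈ P, x = 1 / (p : ℚ)})
    (hN : N = AddSubmonoid.closure {x : ℚ | ∃ p ∈ Q, x = 1 / (p : ℚ)}) :
    IsEmpty (AddMonoidAlgebra F M ≃* AddMonoidAlgebra F N) := by
  refine ⟨fun e => ?_⟩
  obtain ⟨dM, hMmul, -, hMsingle⟩ :=
    exists_puiseux_degree F (M := M) fun x hx => nonneg_of_mem_closure_reciprocals (hM.le hx)
  obtain ⟨dN, hNmul, hNunit, -⟩ :=
    exists_puiseux_degree F (M := N) fun x hx => nonneg_of_mem_closure_reciprocals (hN.le hx)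
  have hmem : ∀ p ∈ P, 1 / (p : ℚ) ∈ M := fun p hp =>
    hM ▸ AddSubmonoid.subset_closure ⟨p, hp, rfl⟩
  obtain ⟨p₀, hp₀⟩ := hinf.nonempty
  have hpow : ∀ p (hp : p ∈ P), p • (⟨1 / (p : ℚ), hmem p hp⟩ : M) =
      p₀ • (⟨1 / (p₀ : ℚ), hmem p₀ hp₀⟩ : M) := fun p hp => by
    have h1 : (p : ℚ) ≠ 0 := Nat.cast_ne_zero.2 (hP p hp).ne_zero
    have h2 : (p₀ : ℚ) ≠ 0 := Nat.cast_ne_zero.2 (hP p₀ hp₀).ne_zero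
    ext
    simp [h1, h2]
  set m : M := p₀ • ⟨1 / (p₀ : ℚ), hmem p₀ hp₀⟩ with hm
  have hm1 : (m : ℚ) = 1 := by
    have h2 : (p₀ : ℚ) ≠ 0 := Nat.cast_ne_zero.2 (hP p₀ hp₀).ne_zero
    simp [hm, h2]
  have hne : ∀ a : M, (single a 1 : AddMonoidAlgebra F M) ≠ 0 := fun a => by simp
  have he : ∀ a : M, e (single a 1) ≠ 0 := fun a => (map_ne_zero_iff e e.injective).2 (hne a)
  have hone : dN 1 = 0 := by
    have := hNmul 1 1 one_ne_zero one_ne_zero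
    rwa [mul_one, left_eq_add] at this
  have hNpow : ∀ f, f ≠ 0 → ∀ n : ℕ, dN (f ^ n) = n • dN f := fun f hf n => by
    induction n with
    | zero => rw [pow_zero, zero_nsmul, hone]
    | succ n ih => rw [pow_succ, hNmul _ _ (pow_ne_zero n hf) hf, ih, succ_nsmul]
  have hdeg : (dN (e (single m 1)) : ℚ) = 0 := by
    refine Rat.eq_zero_of_infinite_prime_dvd hP hinf fun p hp =>
      ⟨dN (e (single ⟨1 / (p : ℚ), hmem p hp⟩ 1)), ?_, ?_⟩
    · refine Rat.not_dvd_den_of_mem_closure (hP p hp) ?_ (hN.le (dN _).2)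
      rintro _ ⟨q, hq, rfl⟩ h
      rw [Rat.den_one_div_prime (hQ q hq), Nat.prime_dvd_prime_iff_eq (hP p hp) (hQ q hq)] at h
      exact Set.disjoint_left.1 hdisj hp (h ▸ hq)
    · have := hNpow _ (he ⟨1 / (p : ℚ), hmem p hp⟩) p
      rw [← map_pow, single_pow, one_pow, hpow p hp] at this
      rw [this, AddSubmonoidClass.coe_nsmul, nsmul_eq_mul]
  have hunit : IsUnit (single m 1 : AddMonoidAlgebra F M) :=
    (MulEquiv.isUnit_map e).1 (hNunit _ (he m) (Subtype.ext hdeg))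
  obtain ⟨g, hg⟩ := hunit.exists_right_inv
  have hg0 : g ≠ 0 := right_ne_zero_of_mul (hg ▸ one_ne_zero)
  have hsum : m + dM g = 0 := by
    rw [← hMsingle (m + dM g), ← hMsingle m, ← hMmul _ _ (hne m) hg0, hg, hMsingle, one_def,
      hMsingle]
  have hnonneg : (0 : ℚ) ≤ dM g := nonneg_of_mem_closure_reciprocals (hM.le (dM g).2)
  have := congrArg (Subtype.val) hsum
  rw [AddSubmonoid.coe_add, hm1, AddSubmonoid.coe_zero] at this
  linarith


/-- Let `F` be a field and `(P n)` pairwise disjoint infinite sets of primes; for each `n` let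
`M n` be the additive submonoid of `ℚ` generated by `{1/p : p ∈ P n}`.  Then each `F[M n]` is
atomic, no `M n` is finitely generated, and for `j ≠ k` the algebras `F[M j]` and `F[M k]` are
non-isomorphic `F`-algebras. -/
theorem atomic_puiseux_algebra_family (F : Type*) [Field F]
    (P : ℕ → Set ℕ) (hPprime : ∀ n, ∀ p ∈ P n, Nat.Prime p) (hPinf : ∀ n, (P n).Infinite)
    (hPdisj : ∀ j k, j ≠ k → Disjoint (P j) (P k))
    (M : ℕ → AddSubmonoid ℚ)
    (hM : ∀ n, M n = AddSubmonoid.closure {x : ℚ | ∃ p ∈ P n, x = 1 / (p : ℚ)}) :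
    (∀ n, ∀ f : AddMonoidAlgebra F (M n), f ≠ 0 → ¬ IsUnit f →
        ∃ s : Multiset (AddMonoidAlgebra F (M n)), (∀ g ∈ s, Irreducible g) ∧ s.prod = f) ∧
      (∀ n, ¬ (M n).FG) ∧
        ∀ j k, j ≠ k →
          ¬ Nonempty (AddMonoidAlgebra F (M j) ≃ₐ[F] AddMonoidAlgebra F (M k)) := by
  refine ⟨fun n f hf hu => ?_, fun n => ?_, fun j k hjk => ?_⟩
  · obtain ⟨r, hr⟩ := exists_rank_closure_reciprocals (hPprime n) (hM n)
    have := wfDvdMonoid_of_rank F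
      (fun x hx => nonneg_of_mem_closure_reciprocals ((hM n).le hx)) hr
    obtain ⟨s, hs, hprod, -⟩ := (WfDvdMonoid.not_isUnit_iff_exists_factors_eq f hf).1 hu
    exact ⟨s, hs, hprod⟩
  · rw [hM n]
    exact not_fg_closure_reciprocals (hPprime n) (hPinf n)
  · rintro ⟨e⟩
    exact (isEmpty_mulEquiv_of_disjoint F (hPprime j) (hPinf j) (hPprime k) (hPdisj j k hjk)
      (hM j) (hM k)).false e.toMulEquiv
end

section
/- Let F be a field and M a nontrivial Puiseux monoid. Then the Puiseux algebra F[M] is a half-factorial domain if and only if M is cyclic, i.e., M is generated by a single positive rational number (equivalently, M is isomorphic as an additive monoid to the natural numbers under addition). -/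
/-- An integral domain is half-factorial if it is atomic and any two factorizations of the same
element into irreducibles have the same length. -/
def IsHalfFactorial (R : Type*) [CommMonoidWithZero R] : Prop :=
  (∀ f : R, f ≠ 0 → ¬ IsUnit f →
      ∃ s : Multiset R, (∀ g ∈ s, Irreducible g) ∧ s.prod = f) ∧
    ∀ s t : Multiset R, (∀ g ∈ s, Irreducible g) → (∀ g ∈ t, Irreducible g) →
      s.prod = t.prod → Multiset.card s = Multiset.card t

theorem UniqueFactorizationMonoid.isHalfFactorial (R : Type*) [CommMonoidWithZero R]
    [UniqueFactorizationMonoid R] : IsHalfFactorial R := by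
  constructor
  · intro f hf hu
    obtain ⟨s, hs, hprod, -⟩ := (WfDvdMonoid.not_isUnit_iff_exists_factors_eq f hf).1 hu
    exact ⟨s, hs, hprod⟩
  · intro s t hs ht h
    exact Multiset.card_eq_card_of_rel
      (UniqueFactorizationMonoid.factors_unique hs ht (h ▸ Associated.refl _))

namespace AddMonoidAlgebra

section TwoUniqueSums

variable {F A : Type*} [Semiring F] [NoZeroDivisors F] [Add A] [TwoUniqueSums A]

theorem exists_eq_single_of_mul_eq_single {f g : AddMonoidAlgebra F A} {x : A} {c : F}
    (hc : c ≠ 0) (h : f * g = single x c) :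
    ∃ a b u v, f = single a u ∧ g = single b v ∧ a + b = x ∧ u ≠ 0 ∧ v ≠ 0 := by
  have hfg : f * g ≠ 0 := by
    rw [h]; simpa using hc
  have hf : f ≠ 0 := by rintro rfl; simp at hfg
  have hg : g ≠ 0 := by rintro rfl; simp at hfg
  have key : ∀ p ∈ f.coeff.support ×ˢ g.coeff.support,
      UniqueAdd f.coeff.support g.coeff.support p.1 p.2 → p.1 + p.2 = x := by
    intro p hp hu
    rw [Finset.mem_product, Finsupp.mem_support_iff, Finsupp.mem_support_iff] at hp
    by_contra hne
    have h1 := coeff_mul_add_of_uniqueAdd hu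
    rw [h, coeff_single, Finsupp.single_eq_of_ne hne] at h1
    exact mul_ne_zero hp.1 hp.2 h1.symm
  have hcard : f.coeff.support.card * g.coeff.support.card ≤ 1 := by
    by_contra! hlt
    obtain ⟨p, hp, q, hq, hne, hup, huq⟩ := TwoUniqueSums.uniqueAdd_of_one_lt_card hlt
    have hpq := (key p hp hup).trans (key q hq huq).symm
    rw [Finset.mem_product] at hp
    have := huq hp.1 hp.2 hpq
    exact hne (Prod.ext this.1 this.2)
  have hf' : 0 < f.coeff.support.card := by
    simpa [Finset.card_pos, Finsupp.support_nonempty_iff] using hf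
  have hg' : 0 < g.coeff.support.card := by
    simpa [Finset.card_pos, Finsupp.support_nonempty_iff] using hg
  obtain ⟨a, u, hu, hfa⟩ := Finsupp.card_support_eq_one'.1
    (show f.coeff.support.card = 1 by nlinarith)
  obtain ⟨b, v, hv, hgb⟩ := Finsupp.card_support_eq_one'.1
    (show g.coeff.support.card = 1 by nlinarith)
  have hfa' : f = single a u := coeff_injective hfa
  have hgb' : g = single b v := coeff_injective hgb
  refine ⟨a, b, u, v, hfa', hgb', ?_, hu, hv⟩
  rw [hfa', hgb', single_mul_single] at h
  have := congrArg coeff h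
  rw [coeff_single, coeff_single, Finsupp.single_eq_single_iff] at this
  rcases this with h | h
  · exact h.1
  · exact absurd h.2 hc

end TwoUniqueSums

section Puiseux

variable {F : Type*} [Field F] {M : AddSubmonoid ℚ}

theorem isUnit_single_zero {u : F} (hu : u ≠ 0) :
    IsUnit (single 0 u : AddMonoidAlgebra F M) :=
  IsUnit.of_mul_eq_one (single 0 u⁻¹) (by
    rw [single_mul_single, mul_inv_cancel₀ hu, add_zero, one_def])

theorem eq_zero_of_isUnit_single (hM : IsPuiseuxMonoid M) {x : M} {c : F}
    (h : IsUnit (single x c : AddMonoidAlgebra F M)) : x = 0 := by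
  obtain ⟨g, hg⟩ := h.exists_right_inv
  have hc : c ≠ 0 := by
    rintro rfl
    simp at hg
  rw [one_def] at hg
  obtain ⟨a, b, u, v, ha, -, hab, -, -⟩ := exists_eq_single_of_mul_eq_single one_ne_zero hg
  have := congrArg coeff ha
  rw [coeff_single, coeff_single, Finsupp.single_eq_single_iff] at this
  obtain rfl : x = a := by
    rcases this with h | h
    · exact h.1
    · exact absurd h.1 hc
  have h1 : (x : ℚ) + b = 0 := congrArg Subtype.val hab
  have := hM x x.2
  have := hM b b.2
  exact Subtype.ext (show (x : ℚ) = 0 by linarith)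

theorem irreducible_single_one {x : M} {u : F} (hu : u ≠ 0)
    (h : Irreducible (single x u : AddMonoidAlgebra F M)) :
    Irreducible (single x 1 : AddMonoidAlgebra F M) := by
  rwa [← irreducible_isUnit_mul (isUnit_single_zero hu), single_mul_single, zero_add, mul_one]

theorem pos_of_irreducible_single (hM : IsPuiseuxMonoid M) {x : M} {u : F} (hu : u ≠ 0)
    (h : Irreducible (single x u : AddMonoidAlgebra F M)) : 0 < (x : ℚ) := by
  refine lt_of_le_of_ne (hM x x.2) fun h0 => h.not_isUnit ?_
  obtain rfl : x = 0 := Subtype.ext h0.symm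
  exact isUnit_single_zero hu

theorem eq_of_irreducible_single (hM : IsPuiseuxMonoid M)
    (hH : IsHalfFactorial (AddMonoidAlgebra F M)) {x y : M} {u v : F} (hu : u ≠ 0) (hv : v ≠ 0)
    (hx : Irreducible (single x u : AddMonoidAlgebra F M))
    (hy : Irreducible (single y v : AddMonoidAlgebra F M)) : x = y := by
  have hx0 := pos_of_irreducible_single hM hu hx
  have hy0 := pos_of_irreducible_single hM hv hy
  have hxn : 0 < (x : ℚ).num.toNat := by have := Rat.num_pos.2 hx0; omega
  set m := (y : ℚ).num.toNat * (x : ℚ).den with hm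
  set n := (x : ℚ).num.toNat * (y : ℚ).den with hn
  have cast_num (z : ℚ) (hz : 0 < z) : (z.num.toNat : ℚ) = z * z.den := by
    rw [Rat.mul_den_eq_num]
    exact_mod_cast Int.toNat_of_nonneg (Rat.num_pos.2 hz).le
  have hmn : m • x = n • y := by
    ext
    push_cast [hm, hn, nsmul_eq_mul, cast_num _ hx0, cast_num _ hy0]
    ring
  have hcard := hH.2 (Multiset.replicate m (single x 1)) (Multiset.replicate n (single y 1))
    (fun g hg => Multiset.eq_of_mem_replicate hg ▸ irreducible_single_one hu hx)
    (fun g hg => Multiset.eq_of_mem_replicate hg ▸ irreducible_single_one hv hy)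
    (by simp [single_pow, hmn])
  rw [Multiset.card_replicate, Multiset.card_replicate] at hcard
  have hn0 : n ≠ 0 := (Nat.mul_pos hxn (y : ℚ).den_pos).ne'
  rw [hcard] at hmn
  have hmn' : (n : ℚ) * x = n * y := by
    simpa [nsmul_eq_mul] using congrArg (Subtype.val : M → ℚ) hmn
  exact Subtype.ext (mul_left_cancel₀ (by exact_mod_cast hn0) hmn')

theorem eq_card_nsmul_of_prod_eq_single (hM : IsPuiseuxMonoid M) {a : M}
    (ha : ∀ (b : M) (u : F), u ≠ 0 → Irreducible (single b u : AddMonoidAlgebra F M) → b = a)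
    (s : Multiset (AddMonoidAlgebra F M)) (hs : ∀ g ∈ s, Irreducible g) {x : M} {c : F}
    (hc : c ≠ 0) (h : s.prod = single x c) : x = Multiset.card s • a := by
  induction s using Multiset.induction_on generalizing x c with
  | empty =>
    rw [Multiset.prod_zero] at h
    simpa using eq_zero_of_isUnit_single hM (h ▸ isUnit_one)
  | cons g s ih =>
    rw [Multiset.prod_cons] at h
    obtain ⟨b, y, u, v, rfl, hy, rfl, hu, hv⟩ := exists_eq_single_of_mul_eq_single hc h
    rw [ih (fun g hg => hs g (Multiset.mem_cons_of_mem hg)) hv hy,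
      ha b u hu (hs _ (Multiset.mem_cons_self _ _)), Multiset.card_cons, succ_nsmul']

end Puiseux

end AddMonoidAlgebra

/-- For a field `F` and a nontrivial Puiseux monoid `M`, the Puiseux algebra `F[M]` is
half-factorial if and only if `M` is cyclic, generated by a single positive rational. -/
theorem puiseux_algebra_half_factorial_iff_cyclic (F : Type*) [Field F]
    (M : AddSubmonoid ℚ) (hM : IsPuiseuxMonoid M) (hMnt : M ≠ ⊥) :
    IsHalfFactorial (AddMonoidAlgebra F M) ↔
      ∃ q : ℚ, 0 < q ∧ M = AddSubmonoid.closure {q} := by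
  constructor
  · intro hH
    have factor (x : M) (hx : x ≠ 0) := hH.1 (.single x 1) (by simp)
      fun hu => hx (AddMonoidAlgebra.eq_zero_of_isUnit_single hM hu)
    obtain ⟨x, hxM, hx0⟩ := M.bot_or_exists_ne_zero.resolve_left hMnt
    have hx : (⟨x, hxM⟩ : M) ≠ 0 := fun h => hx0 (congrArg Subtype.val h)
    obtain ⟨s, hs, hprod⟩ := factor _ hx
    obtain ⟨g, hg⟩ : ∃ g, g ∈ s := by
      refine Multiset.exists_mem_of_ne_zero ?_
      rintro rfl
      rw [Multiset.prod_zero] at hprod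
      exact hx (AddMonoidAlgebra.eq_zero_of_isUnit_single hM (hprod ▸ isUnit_one))
    obtain ⟨t, rfl⟩ := Multiset.exists_cons_of_mem hg
    rw [Multiset.prod_cons] at hprod
    obtain ⟨a, -, u, -, rfl, -, -, hu, -⟩ :=
      AddMonoidAlgebra.exists_eq_single_of_mul_eq_single one_ne_zero hprod
    have ha := hs _ hg
    refine ⟨a, AddMonoidAlgebra.pos_of_irreducible_single hM hu ha, le_antisymm ?_ ?_⟩
    · intro y hy
      rw [AddSubmonoid.mem_closure_singleton]
      by_cases hy0 : y = 0
      · exact ⟨0, by simp [hy0]⟩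
      · obtain ⟨r, hr, hrprod⟩ := factor ⟨y, hy⟩ fun h => hy0 (congrArg Subtype.val h)
        have := AddMonoidAlgebra.eq_card_nsmul_of_prod_eq_single hM
          (fun b v hv hb => AddMonoidAlgebra.eq_of_irreducible_single hM hH hv hu hb ha)
          r hr one_ne_zero hrprod
        exact ⟨_, (congrArg Subtype.val this).symm⟩
    · simp
  · rintro ⟨q, hq, rfl⟩
    let φ : ℕ →+ AddSubmonoid.closure {q} :=
      multiplesHom _ ⟨q, AddSubmonoid.subset_closure rfl⟩
    have hφ (n : ℕ) : (φ n : ℚ) = n * q := by simp [φ]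
    have hbij : Function.Bijective φ := by
      constructor
      · intro m n h
        have := congrArg Subtype.val h
        rw [hφ, hφ] at this
        exact_mod_cast mul_right_cancel₀ hq.ne' this
      · rintro ⟨y, hy⟩
        obtain ⟨n, rfl⟩ := AddSubmonoid.mem_closure_singleton.1 hy
        exact ⟨n, Subtype.ext ((hφ n).trans (nsmul_eq_mul n q).symm)⟩
    have := MulEquiv.uniqueFactorizationMonoid
      ((Polynomial.toFinsuppIso F).toMulEquiv.trans
        (AddMonoidAlgebra.domCongr F F (AddEquiv.ofBijective φ hbij)).toMulEquiv) inferInstance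
    exact UniqueFactorizationMonoid.isHalfFactorial _
end

section
/- A nontrivial root-closed Puiseux monoid M is atomic if and only if M is cyclic, i.e., generated by a single positive rational number. -/
/-- A Puiseux monoid `M` is root-closed if every `x ∈ ℚ` lying in the difference group of `M`
with `n • x ∈ M` for some positive integer `n` belongs to `M`. -/
def IsRootClosedPM (M : AddSubmonoid ℚ) : Prop :=
  ∀ x : ℚ, (∃ a ∈ M, ∃ b ∈ M, x = a - b) → (∃ n : ℕ, 0 < n ∧ (n : ℚ) * x ∈ M) → x ∈ M

/-- `a` is an atom of the Puiseux monoid `M`. -/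
def IsAtomOf (M : AddSubmonoid ℚ) (a : ℚ) : Prop :=
  a ∈ M ∧ a ≠ 0 ∧ ∀ x ∈ M, ∀ y ∈ M, a = x + y → x = 0 ∨ y = 0

/-- A Puiseux monoid is atomic if every element is a finite sum of atoms. -/
def IsAtomicPM (M : AddSubmonoid ℚ) : Prop :=
  ∀ x ∈ M, ∃ s : Multiset ℚ, (∀ a ∈ s, IsAtomOf M a) ∧ s.sum = x

/-- A Puiseux monoid is antimatter if it has no atoms. -/
def IsAntimatterPM (M : AddSubmonoid ℚ) : Prop := ¬ ∃ a : ℚ, IsAtomOf M a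

/-- A root-closed Puiseux monoid is closed under nonnegative differences. -/
theorem IsRootClosedPM.sub_mem {M : AddSubmonoid ℚ} (hrc : IsRootClosedPM M) {a b : ℚ}
    (ha : a ∈ M) (hb : b ∈ M) (hb0 : 0 ≤ b) (hab : b ≤ a) : a - b ∈ M := by
  rcases hab.eq_or_lt with rfl | hlt
  · simp
  have hx : 0 < a - b := sub_pos.mpr hlt
  have ha0 : 0 < a := hb0.trans_lt hlt
  refine hrc _ ⟨a, ha, b, hb, rfl⟩ ⟨(a - b).den * a.num.toNat,
    Nat.mul_pos (a - b).den_pos (by have := Rat.num_pos.mpr ha0; omega), ?_⟩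
  have hmem := M.nsmul_mem ha ((a - b).num.toNat * a.den)
  convert hmem using 1
  have hnum_a : ((a.num.toNat : ℕ) : ℚ) = a.num := by
    exact_mod_cast Int.toNat_of_nonneg (Rat.num_pos.mpr ha0).le
  have hnum_x : (((a - b).num.toNat : ℕ) : ℚ) = (a - b).num := by
    exact_mod_cast Int.toNat_of_nonneg (Rat.num_pos.mpr hx).le
  rw [nsmul_eq_mul]
  push_cast
  rw [hnum_a, hnum_x, ← Rat.mul_den_eq_num a, ← Rat.mul_den_eq_num (a - b)]
  ring

/-- A root-closed Puiseux monoid has at most one atom. -/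
theorem IsAtomOf.eq_of_isRootClosedPM {M : AddSubmonoid ℚ} (hM : IsPuiseuxMonoid M)
    (hrc : IsRootClosedPM M) {a b : ℚ} (ha : IsAtomOf M a) (hb : IsAtomOf M b) : a = b := by
  wlog hab : b ≤ a generalizing a b
  · exact (this hb ha (le_of_not_ge hab)).symm
  rcases ha.2.2 b hb.1 (a - b) (hrc.sub_mem ha.1 hb.1 (hM b hb.1) hab) (by ring) with h | h
  · exact absurd h hb.2.1
  · exact sub_eq_zero.mp h

/-- A positive rational number is an atom of the monoid it generates. -/
theorem isAtomOf_closure_singleton {q : ℚ} (hq : 0 < q) :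
    IsAtomOf (AddSubmonoid.closure {q}) q := by
  refine ⟨AddSubmonoid.subset_closure rfl, hq.ne', fun x hx y hy h => ?_⟩
  obtain ⟨m, rfl⟩ := AddSubmonoid.mem_closure_singleton.mp hx
  obtain ⟨n, rfl⟩ := AddSubmonoid.mem_closure_singleton.mp hy
  simp only [nsmul_eq_mul] at h ⊢
  have hsum : ((m : ℚ) + n) = 1 := mul_right_cancel₀ hq.ne' (by linarith)
  have hsum' : m + n = 1 := by exact_mod_cast hsum
  rcases Nat.eq_zero_or_pos m with rfl | hm
  · simp
  · obtain rfl : n = 0 := by omega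
    simp

/-- A nontrivial root-closed Puiseux monoid is atomic if and only if it is cyclic, i.e.,
generated by a single positive rational number. -/
theorem rootClosed_atomic_iff_cyclic (M : AddSubmonoid ℚ) (hM : IsPuiseuxMonoid M)
    (hMnt : M ≠ ⊥) (hrc : IsRootClosedPM M) :
    IsAtomicPM M ↔ ∃ q : ℚ, 0 < q ∧ M = AddSubmonoid.closure {q} := by
  constructor
  · intro hat
    obtain ⟨x, hx, hx0⟩ := M.bot_or_exists_ne_zero.resolve_left hMnt
    obtain ⟨s, hs, hsum⟩ := hat x hx
    obtain ⟨q, hqs⟩ := Multiset.exists_mem_of_ne_zero (s := s) (by rintro rfl; exact hx0 hsum.symm)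
    have hq := hs q hqs
    refine ⟨q, (hM q hq.1).lt_of_ne' hq.2.1, le_antisymm (fun y hy => ?_) ?_⟩
    · obtain ⟨t, ht, rfl⟩ := hat y hy
      rw [Multiset.eq_replicate_card.mpr
        fun a ha => (ht a ha).eq_of_isRootClosedPM hM hrc hq, Multiset.sum_replicate]
      exact AddSubmonoid.mem_closure_singleton.mpr ⟨_, rfl⟩
    · simpa using hq.1
  · rintro ⟨q, hq, rfl⟩ x hx
    obtain ⟨n, rfl⟩ := AddSubmonoid.mem_closure_singleton.mp hx
    refine ⟨Multiset.replicate n q, fun a ha => ?_, Multiset.sum_replicate n q⟩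
    rw [Multiset.eq_of_mem_replicate ha]
    exact isAtomOf_closure_singleton hq
end

section
/- Let M be the additive submonoid of ℚ generated by {1/2^n : n ∈ ℕ} ∪ {1/3^n : n ∈ ℕ}. Then 1/6 ∉ M; consequently M is an antimatter Puiseux monoid (it has no atoms) that is not root-closed, since 1/6 = 1/2 − 1/3 lies in the difference group of M and 6·(1/6) = 1 ∈ M. -/
/-- The set `{1/2^n, 1/3^n : n ≥ 1}` of rationals. -/
def invPowTwoThree : Set ℚ :=
  (Set.range fun n : ℕ => (1 : ℚ) / 2 ^ (n + 1)) ∪ (Set.range fun n : ℕ => (1 : ℚ) / 3 ^ (n + 1))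

theorem exists_eq_add_of_mem_closure_invPowTwoThree {x : ℚ}
    (hx : x ∈ AddSubmonoid.closure invPowTwoThree) :
    ∃ m n a b : ℕ, x = a / 2 ^ (m + 1) + b / 3 ^ (n + 1) := by
  induction hx using AddSubmonoid.closure_induction with
  | mem x hx =>
    rcases hx with ⟨n, rfl⟩ | ⟨n, rfl⟩
    · exact ⟨n, 0, 1, 0, by simp⟩
    · exact ⟨0, n, 0, 1, by simp⟩
  | zero => exact ⟨0, 0, 0, 0, by simp⟩
  | add x y _ _ hx hy =>
    obtain ⟨m, n, a, b, rfl⟩ := hx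
    obtain ⟨m', n', a', b', rfl⟩ := hy
    refine ⟨m + m' + 1, n + n' + 1, a * 2 ^ (m' + 1) + a' * 2 ^ (m + 1),
      b * 3 ^ (n' + 1) + b' * 3 ^ (n + 1), ?_⟩
    push_cast
    rw [show m + m' + 1 + 1 = (m + 1) + (m' + 1) by ring,
      show n + n' + 1 + 1 = (n + 1) + (n' + 1) by ring, pow_add, pow_add (3 : ℚ)]
    field_simp
    ring

theorem one_div_six_notMem_closure_invPowTwoThree :
    (1 / 6 : ℚ) ∉ AddSubmonoid.closure invPowTwoThree := by
  intro h
  obtain ⟨m, n, a, b, h⟩ := exists_eq_add_of_mem_closure_invPowTwoThree h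
  have key : a * 3 * 3 ^ n + b * 2 * 2 ^ m = 2 ^ m * 3 ^ n := by
    have : (a * 3 * 3 ^ n + b * 2 * 2 ^ m : ℚ) = 2 ^ m * 3 ^ n := by
      rw [pow_succ, pow_succ] at h
      field_simp at h
      linarith
    exact_mod_cast this
  have ha : 2 ^ m ∣ a * 3 := by
    have h1 : 2 ^ m ∣ a * 3 * 3 ^ n :=
      (Nat.dvd_add_left (Dvd.intro_left _ rfl)).1 (key ▸ Dvd.intro _ rfl)
    exact (Nat.Coprime.pow m n (by norm_num)).dvd_of_dvd_mul_right h1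
  obtain ⟨a, rfl⟩ := (Nat.Coprime.pow_left m (by norm_num)).dvd_of_dvd_mul_right ha
  have hb : 3 ^ n ∣ b * 2 := by
    have h1 : 3 ^ n ∣ b * 2 * 2 ^ m :=
      (Nat.dvd_add_right (Dvd.intro_left _ rfl)).1 (key ▸ Dvd.intro_left _ rfl)
    exact (Nat.Coprime.pow n m (by norm_num)).dvd_of_dvd_mul_right h1
  obtain ⟨b, rfl⟩ := (Nat.Coprime.pow_left n (by norm_num)).dvd_of_dvd_mul_right hb
  have h1 : 2 ^ m * 3 ^ n * (3 * a + 2 * b) = 2 ^ m * 3 ^ n * 1 := by linarith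
  have h2 := Nat.eq_of_mul_eq_mul_left (by positivity) h1
  omega

theorem eq_zero_or_exists_add_of_mem_closure_invPowTwoThree {x : ℚ}
    (hx : x ∈ AddSubmonoid.closure invPowTwoThree) :
    x = 0 ∨ ∃ y ∈ AddSubmonoid.closure invPowTwoThree,
      ∃ z ∈ AddSubmonoid.closure invPowTwoThree, x = y + z ∧ y ≠ 0 ∧ z ≠ 0 := by
  induction hx using AddSubmonoid.closure_induction with
  | mem x hx =>
    right
    rcases hx with ⟨n, rfl⟩ | ⟨n, rfl⟩
    · have h : (1 : ℚ) / 2 ^ (n + 1 + 1) ∈ AddSubmonoid.closure invPowTwoThree :=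
        AddSubmonoid.subset_closure (Or.inl ⟨n + 1, rfl⟩)
      refine ⟨_, h, _, h, ?_, by positivity, by positivity⟩
      simp only [pow_succ]
      field_simp
      norm_num
    · have h : (1 : ℚ) / 3 ^ (n + 1 + 1) ∈ AddSubmonoid.closure invPowTwoThree :=
        AddSubmonoid.subset_closure (Or.inr ⟨n + 1, rfl⟩)
      refine ⟨_, h, _, add_mem h h, ?_, by positivity, by positivity⟩
      simp only [pow_succ]
      field_simp
      norm_num
  | zero => exact Or.inl rfl
  | add x y hx hy ihx ihy =>
    by_cases hx0 : x = 0
    · simpa [hx0] using ihy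
    by_cases hy0 : y = 0
    · simpa [hy0] using ihx
    exact Or.inr ⟨x, hx, y, hy, rfl, hx0, hy0⟩


/-- Let `M` be the additive submonoid of `ℚ` generated by `{1/2^n, 1/3^n : n ≥ 1}`.  Then
`1/6 ∉ M`; consequently `M` is an antimatter Puiseux monoid which is not root-closed. -/
theorem antimatter_not_rootClosed_example (M : AddSubmonoid ℚ)
    (hM : M = AddSubmonoid.closure
        ((Set.range fun n : ℕ => (1 : ℚ) / 2 ^ (n + 1)) ∪
          (Set.range fun n : ℕ => (1 : ℚ) / 3 ^ (n + 1)))) :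
    (1 / 6 : ℚ) ∉ M ∧ IsAntimatterPM M ∧ ¬ IsRootClosedPM M := by
  change M = AddSubmonoid.closure invPowTwoThree at hM
  subst hM
  refine ⟨one_div_six_notMem_closure_invPowTwoThree, ?_, fun h => ?_⟩
  · rintro ⟨a, ha, ha0, hatom⟩
    rcases eq_zero_or_exists_add_of_mem_closure_invPowTwoThree ha with
      h | ⟨y, hy, z, hz, h, hy0, hz0⟩
    · exact ha0 h
    · exact (hatom y hy z hz h).elim hy0 hz0
  · have h2 : (1 / 2 : ℚ) ∈ AddSubmonoid.closure invPowTwoThree :=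
      AddSubmonoid.subset_closure (Or.inl ⟨0, by norm_num⟩)
    have h3 : (1 / 3 : ℚ) ∈ AddSubmonoid.closure invPowTwoThree :=
      AddSubmonoid.subset_closure (Or.inr ⟨0, by norm_num⟩)
    refine one_div_six_notMem_closure_invPowTwoThree
      (h _ ⟨_, h2, _, h3, by norm_num⟩ ⟨6, by norm_num, ?_⟩)
    convert add_mem h2 h2 using 1
    norm_num
end

section
/- Let F be an algebraically closed field and let M be a nontrivial root-closed Puiseux monoid that is not antimatter (i.e., M has at least one atom). Then the Puiseux algebra F[M] is isomorphic as an F-algebra to the polynomial ring F[X]. -/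
/-- A root-closed Puiseux monoid with a nonzero element consists of all the nonnegative elements of
its difference group. -/
theorem IsRootClosedPM.sub_mem_of_le {M : AddSubmonoid ℚ} (hrc : IsRootClosedPM M) {c : ℚ}
    (hc : c ∈ M) (hc0 : 0 < c) {a b : ℚ} (ha : a ∈ M) (hb : b ∈ M) (hab : b ≤ a) : a - b ∈ M := by
  refine hrc _ ⟨a, ha, b, hb, rfl⟩ ⟨((a - b) / c).den, Rat.den_pos _, ?_⟩
  have hr : 0 ≤ (a - b) / c := div_nonneg (sub_nonneg.2 hab) hc0.le
  have hnum : ((((a - b) / c).num.toNat : ℕ) : ℚ) = ((a - b) / c).num := by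
    exact_mod_cast Int.toNat_of_nonneg (Rat.num_nonneg.2 hr)
  have key : (((a - b) / c).den : ℚ) * (a - b) = ((a - b) / c).num.toNat • c := by
    rw [nsmul_eq_mul, hnum, ← Rat.den_mul_eq_num, mul_assoc, div_mul_cancel₀ _ hc0.ne']
  rw [key]
  exact M.nsmul_mem hc _

/-- Every element of a root-closed Puiseux monoid is a multiple of any given atom. -/
theorem IsRootClosedPM.exists_nsmul_eq {M : AddSubmonoid ℚ} (hM : IsPuiseuxMonoid M)
    (hrc : IsRootClosedPM M) {a : ℚ} (ha : IsAtomOf M a) {x : ℚ} (hx : x ∈ M) :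
    ∃ n : ℕ, n • a = x := by
  obtain ⟨haM, ha0, hatom⟩ := ha
  have hapos : 0 < a := lt_of_le_of_ne (hM a haM) ha0.symm
  have hle : ⌊x / a⌋₊ • a ≤ x := by
    rw [nsmul_eq_mul, ← le_div_iff₀ hapos]
    exact Nat.floor_le (div_nonneg (hM x hx) hapos.le)
  have hlt : x < (⌊x / a⌋₊ + 1) • a := by
    rw [nsmul_eq_mul, ← div_lt_iff₀ hapos]
    exact_mod_cast Nat.lt_floor_add_one (x / a)
  have hy := hrc.sub_mem_of_le haM hapos hx (M.nsmul_mem haM _) hle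
  have hz := hrc.sub_mem_of_le haM hapos (M.nsmul_mem haM _) hx hlt.le
  refine ⟨⌊x / a⌋₊, ?_⟩
  rcases hatom _ hy _ hz (by rw [succ_nsmul]; ring) with h | h
  · exact (sub_eq_zero.1 h).symm
  · exact absurd (sub_eq_zero.1 h) hlt.ne'

/-- If `F` is an algebraically closed field and `M` is a nontrivial root-closed Puiseux monoid
that is not antimatter, then the Puiseux algebra `F[M]` is isomorphic as an `F`-algebra to the
polynomial ring `F[X]`. -/
theorem rootClosed_not_antimatter_algebra_iso_polynomial (F : Type*) [Field F] [IsAlgClosed F]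
    (M : AddSubmonoid ℚ) (hM : IsPuiseuxMonoid M) (hMnt : M ≠ ⊥)
    (hrc : IsRootClosedPM M) (hatom : ∃ a : ℚ, IsAtomOf M a) :
    Nonempty (AddMonoidAlgebra F M ≃ₐ[F] Polynomial F) := by
  obtain ⟨a, ha⟩ := hatom
  have hbij : Function.Bijective (multiplesHom M ⟨a, ha.1⟩) := by
    refine ⟨fun m n h => ?_, fun x => ?_⟩
    · have h' : m • a = n • a := congrArg Subtype.val h
      simpa [nsmul_eq_mul, ha.2.1] using h'
    · obtain ⟨n, hn⟩ := hrc.exists_nsmul_eq hM ha x.2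
      exact ⟨n, Subtype.ext hn⟩
  exact ⟨(AddMonoidAlgebra.domCongr F F (AddEquiv.ofBijective _ hbij).symm).trans
    (Polynomial.toFinsuppIsoAlg F).symm⟩
end

section
/- Let F be an algebraically closed field and, for each prime p, let M_p be the additive submonoid of ℚ generated by {1/p^n : n ∈ ℕ}. Then for every prime p different from the characteristic of F, the Puiseux algebra F[M_p] is an antimatter domain (it contains no irreducible elements), and for distinct primes p and q, both different from the characteristic of F, the algebras F[M_p] and F[M_q] are not isomorphic as F-algebras. -/
namespace PuiseuxAlgebra

open Polynomial

/-- The Puiseux monoid generated by the inverses of the positive powers of `p`. -/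
abbrev invPowMonoid (p : ℕ) : AddSubmonoid ℚ :=
  AddSubmonoid.closure (Set.range fun n : ℕ => (1 : ℚ) / (p : ℚ) ^ (n + 1))

/-- The generator `1 / p ^ (n + 1)` of `invPowMonoid p`. -/
def invPow (p n : ℕ) : invPowMonoid p :=
  ⟨1 / (p : ℚ) ^ (n + 1), AddSubmonoid.subset_closure ⟨n, rfl⟩⟩

theorem invPow_pos {p : ℕ} (hp : p ≠ 0) (n : ℕ) : (0 : ℚ) < invPow p n := by
  have : (0 : ℚ) < p := by positivity
  change (0 : ℚ) < 1 / (p : ℚ) ^ (n + 1)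
  positivity

theorem pow_nsmul_invPow_add {p : ℕ} (hp : p ≠ 0) (n k : ℕ) :
    p ^ k • invPow p (n + k) = invPow p n := by
  have : (p : ℚ) ≠ 0 := by exact_mod_cast hp
  apply Subtype.ext
  simp only [invPow, AddSubmonoidClass.coe_nsmul, nsmul_eq_mul, Nat.cast_pow]
  field_simp
  ring

theorem exists_eq_nsmul_invPow {p : ℕ} (hp : p ≠ 0) (m : invPowMonoid p) :
    ∃ n k : ℕ, m = k • invPow p n := by
  obtain ⟨x, hx⟩ := m
  induction hx using AddSubmonoid.closure_induction with
  | mem x hx =>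
    obtain ⟨n, rfl⟩ := hx
    exact ⟨n, 1, (one_nsmul _).symm⟩
  | zero => exact ⟨0, 0, (zero_nsmul _).symm⟩
  | add x y hx hy ihx ihy =>
    obtain ⟨n, k, h⟩ := ihx
    obtain ⟨m, l, h'⟩ := ihy
    refine ⟨n + m, p ^ m * k + p ^ n * l, ?_⟩
    change (⟨x, hx⟩ : invPowMonoid p) + ⟨y, hy⟩ = _
    rw [h, h', ← pow_nsmul_invPow_add hp n m, ← pow_nsmul_invPow_add hp m n, add_comm m n,
      add_nsmul, mul_nsmul, mul_nsmul]

variable (F : Type*) [Field F]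

/-- Substitution of `X ^ (1 / p ^ (n + 1))` into polynomials. -/
noncomputable def substInvPow (p n : ℕ) : F[X] →ₐ[F] AddMonoidAlgebra F (invPowMonoid p) :=
  aeval (AddMonoidAlgebra.single (invPow p n) 1)

theorem substInvPow_injective {p : ℕ} (hp : p ≠ 0) (n : ℕ) :
    Function.Injective (substInvPow F p n) := by
  have h : substInvPow F p n = (AddMonoidAlgebra.mapDomainAlgHom F F
      (multiplesHom _ (invPow p n))).comp (toFinsuppIsoAlg F).toAlgHom := by
    ext1
    simp [substInvPow]
  rw [h]
  refine (AddMonoidAlgebra.mapDomain_injective fun a b hab => ?_).comp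
    (toFinsuppIsoAlg F).injective
  have hab' := congrArg (fun x : invPowMonoid p => (x : ℚ)) hab
  simpa [(invPow_pos hp n).ne'] using hab'

variable {F}

theorem substInvPow_expand {p : ℕ} (hp : p ≠ 0) (n k : ℕ) (g : F[X]) :
    substInvPow F p (n + k) (expand F (p ^ k) g) = substInvPow F p n g := by
  simp [substInvPow, expand_aeval, AddMonoidAlgebra.single_pow, pow_nsmul_invPow_add hp]

theorem exists_substInvPow_eq {p : ℕ} (hp : p ≠ 0) (f : AddMonoidAlgebra F (invPowMonoid p)) :
    ∃ n g, substInvPow F p n g = f := by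
  induction f using AddMonoidAlgebra.induction_on with
  | of m =>
    obtain ⟨n, k, rfl⟩ := exists_eq_nsmul_invPow hp m
    exact ⟨n, X ^ k, by simp [substInvPow, AddMonoidAlgebra.single_pow]⟩
  | add f f' hf hf' =>
    obtain ⟨n, g, rfl⟩ := hf
    obtain ⟨m, g', rfl⟩ := hf'
    refine ⟨n + m, expand F (p ^ m) g + expand F (p ^ n) g', ?_⟩
    rw [map_add, substInvPow_expand hp, add_comm n m, substInvPow_expand hp]
  | smul c f hf =>
    obtain ⟨n, g, rfl⟩ := hf
    exact ⟨n, c • g, map_smul _ _ _⟩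

theorem natDegree_eq_zero_of_isUnit_substInvPow {p : ℕ} (hp : p ≠ 0) {n : ℕ} {g : F[X]}
    (hg : IsUnit (substInvPow F p n g)) : g.natDegree = 0 := by
  obtain ⟨v, hv⟩ := hg.exists_right_inv
  obtain ⟨m, w, rfl⟩ := exists_substInvPow_eq hp v
  rw [← substInvPow_expand hp n m, ← substInvPow_expand hp m n, add_comm m n, ← map_mul,
    ← map_one (substInvPow F p (n + m))] at hv
  have h := natDegree_eq_zero_of_isUnit (IsUnit.of_mul_eq_one _ (substInvPow_injective F hp _ hv))
  rw [natDegree_expand] at h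
  exact (mul_eq_zero.mp h).resolve_right (pow_ne_zero _ hp)

theorem not_irreducible [IsAlgClosed F] {p : ℕ} (hp : 1 < p)
    (f : AddMonoidAlgebra F (invPowMonoid p)) : ¬ Irreducible f := by
  have hp0 : p ≠ 0 := by omega
  intro hf
  obtain ⟨n, g, rfl⟩ := exists_substInvPow_eq hp0 f
  have hg : g.natDegree ≠ 0 := by
    intro hg
    obtain ⟨c, rfl⟩ := natDegree_eq_zero.mp hg
    have hc : c ≠ 0 := by
      rintro rfl
      exact hf.ne_zero (by simp)
    exact hf.not_isUnit ((isUnit_C.mpr hc.isUnit).map _)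
  have hdeg : (expand F (p ^ 1) g).natDegree = g.natDegree * p := by
    rw [natDegree_expand, pow_one]
  have hlt : 1 < g.natDegree * p := by nlinarith [Nat.pos_of_ne_zero hg]
  obtain ⟨b, hb⟩ := IsAlgClosed.exists_root (expand F (p ^ 1) g)
    (fun h => by rw [natDegree_eq_zero_iff_degree_le_zero.mpr h.le] at hdeg; omega)
  obtain ⟨k, hk⟩ := dvd_iff_isRoot.mpr hb
  have hk0 : k ≠ 0 := by
    rintro rfl
    rw [hk, mul_zero, natDegree_zero] at hdeg
    omega
  rw [hk, natDegree_mul (X_sub_C_ne_zero b) hk0, natDegree_X_sub_C] at hdeg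
  rw [← substInvPow_expand hp0 n 1, hk, map_mul] at hf
  rcases hf.isUnit_or_isUnit rfl with h | h
  · simpa using natDegree_eq_zero_of_isUnit_substInvPow hp0 h
  · have := natDegree_eq_zero_of_isUnit_substInvPow hp0 h
    omega

theorem exists_algebraMap_eq_of_forall_exists_pow_eq {p q : ℕ} (hp : 1 < p) (hq : q ≠ 0)
    (hpq : p.Coprime q) {f : AddMonoidAlgebra F (invPowMonoid q)}
    (hf : ∀ n : ℕ, ∃ h, h ^ p ^ n = f) : ∃ c : F, algebraMap F _ c = f := by
  obtain ⟨m, g, rfl⟩ := exists_substInvPow_eq hq f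
  have hdvd (n : ℕ) : p ^ n ∣ g.natDegree := by
    obtain ⟨h, hh⟩ := hf n
    obtain ⟨l, k, rfl⟩ := exists_substInvPow_eq hq h
    rw [← substInvPow_expand hq m l, ← substInvPow_expand hq l m, add_comm l m, ← map_pow] at hh
    have hdeg := congrArg natDegree (substInvPow_injective F hq _ hh)
    rw [natDegree_pow, natDegree_expand (q ^ l)] at hdeg
    exact (hpq.pow n l).dvd_of_dvd_mul_right ⟨_, hdeg.symm⟩
  have hg : g.natDegree = 0 :=
    Nat.eq_zero_of_dvd_of_lt (hdvd g.natDegree) (Nat.lt_pow_self hp)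
  obtain ⟨c, rfl⟩ := natDegree_eq_zero.mp hg
  exact ⟨c, by rw [← algebraMap_eq, AlgHom.commutes]⟩

theorem isEmpty_algEquiv {p q : ℕ} (hp : 1 < p) (hq : q ≠ 0) (hpq : p.Coprime q) :
    IsEmpty (AddMonoidAlgebra F (invPowMonoid p) ≃ₐ[F] AddMonoidAlgebra F (invPowMonoid q)) := by
  have hp0 : p ≠ 0 := by omega
  refine ⟨fun e => ?_⟩
  obtain ⟨c, hc⟩ := exists_algebraMap_eq_of_forall_exists_pow_eq hp hq hpq
    (f := e (substInvPow F p 0 X)) fun n => ⟨e (substInvPow F p (0 + n) X), by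
      rw [← map_pow, ← map_pow, ← substInvPow_expand hp0 0 n, expand_X]⟩
  rw [← e.commutes, ← (substInvPow F p 0).commutes, algebraMap_eq] at hc
  have h := congrArg natDegree (substInvPow_injective F hp0 0 (e.injective hc))
  simp at h

end PuiseuxAlgebra


/-- Let `F` be an algebraically closed field and, for each prime `p`, let `M p` be the additive
submonoid of `ℚ` generated by `{1/p^n : n ≥ 1}`.  For every prime `p ≠ char F`, the Puiseux
algebra `F[M p]` is an antimatter domain, and for distinct primes `p, q`, both different from
`char F`, the algebras `F[M p]` and `F[M q]` are non-isomorphic `F`-algebras. -/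
theorem antimatter_puiseux_algebras_over_algClosed (F : Type*) [Field F] [IsAlgClosed F]
    (M : ℕ → AddSubmonoid ℚ)
    (hM : ∀ p : ℕ, M p = AddSubmonoid.closure (Set.range fun n : ℕ => (1 : ℚ) / (p : ℚ) ^ (n + 1))) :
    (∀ p : ℕ, Nat.Prime p → ringChar F ≠ p →
        ¬ ∃ f : AddMonoidAlgebra F (M p), Irreducible f) ∧
      ∀ p q : ℕ, Nat.Prime p → Nat.Prime q → ringChar F ≠ p → ringChar F ≠ q → p ≠ q →
        ¬ Nonempty (AddMonoidAlgebra F (M p) ≃ₐ[F] AddMonoidAlgebra F (M q)) := by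
  obtain rfl : M = PuiseuxAlgebra.invPowMonoid := funext hM
  refine ⟨fun p hp _ ⟨f, hf⟩ => PuiseuxAlgebra.not_irreducible hp.one_lt f hf, ?_⟩
  rintro p q hp hq - - hpq ⟨e⟩
  exact (PuiseuxAlgebra.isEmpty_algEquiv hp.one_lt hq.ne_zero
    ((Nat.coprime_primes hp hq).mpr hpq)).false e
end

section
/- Let F be a perfect field of characteristic p > 0 and let M be a p-divisible Puiseux monoid. Then every element of the Puiseux algebra F[M] is the p-th power of an element of F[M]; in particular, F[M] is an antimatter domain (it contains no irreducible elements). -/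
/-- If `x ↦ x ^ p` is surjective on a commutative ring `R` of characteristic `p` and `m ↦ p • m`
is surjective on `A`, then every element of `R[A]` is a `p`-th power. -/
theorem AddMonoidAlgebra.exists_eq_pow_of_surjective {R A : Type*} [CommRing R] [AddCommMonoid A]
    (p : ℕ) [Fact p.Prime] [CharP R p] (hR : Function.Surjective fun x : R => x ^ p)
    (hA : Function.Surjective fun m : A => p • m) (f : AddMonoidAlgebra R A) :
    ∃ g : AddMonoidAlgebra R A, f = g ^ p := by
  have : CharP (AddMonoidAlgebra R A) p :=
    charP_of_injective_ringHom (f := AddMonoidAlgebra.singleZeroRingHom)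
      AddMonoidAlgebra.single_right_injective p
  induction f using AddMonoidAlgebra.induction_on with
  | of m =>
    obtain ⟨n, rfl⟩ := hA m
    exact ⟨AddMonoidAlgebra.of R A (.ofAdd n), by rw [← map_pow, ← ofAdd_nsmul]⟩
  | add x y hx hy =>
    obtain ⟨a, rfl⟩ := hx
    obtain ⟨b, rfl⟩ := hy
    exact ⟨a + b, (add_pow_char _ _ p).symm⟩
  | smul r x hx =>
    obtain ⟨s, rfl⟩ := hR r
    obtain ⟨a, rfl⟩ := hx
    exact ⟨s • a, (smul_pow s a p).symm⟩

/-- Let `F` be a perfect field of characteristic `p > 0` and `M` a `p`-divisible Puiseux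
monoid.  Then every element of the Puiseux algebra `F[M]` is a `p`-th power; in particular
`F[M]` is an antimatter domain, containing no irreducible elements. -/
theorem perfect_field_p_divisible_antimatter (F : Type*) [Field F] (p : ℕ) [Fact p.Prime]
    [CharP F p] (hperf : Function.Surjective fun x : F => x ^ p)
    (M : AddSubmonoid ℚ) (hM : IsPuiseuxMonoid M)
    (hdiv : ∀ x ∈ M, x / (p : ℚ) ∈ M) :
    (∀ f : AddMonoidAlgebra F M, ∃ g : AddMonoidAlgebra F M, f = g ^ p) ∧
      ¬ ∃ f : AddMonoidAlgebra F M, Irreducible f := by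
  have hp : p.Prime := Fact.out
  have hpow := AddMonoidAlgebra.exists_eq_pow_of_surjective (A := M) p hperf fun x =>
    ⟨⟨(x : ℚ) / p, hdiv x x.2⟩, Subtype.ext <| by
      simp [mul_div_cancel₀ (x : ℚ) (Nat.cast_ne_zero.2 hp.ne_zero)]⟩
  refine ⟨hpow, ?_⟩
  rintro ⟨f, hf⟩
  obtain ⟨g, rfl⟩ := hpow f
  exact not_irreducible_pow hp.ne_one hf
end

section
/- Let M be a root-closed Puiseux monoid with 1 ∈ M. Then for every nonzero r ∈ M, the rational number 1/d(r) belongs to M, where d(r) denotes the denominator of r in lowest terms. -/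
/-- If `M` is a root-closed Puiseux monoid with `1 ∈ M`, then for every nonzero `r ∈ M` the
rational `1/d(r)` belongs to `M`, where `d(r)` is the denominator of `r` in lowest terms. -/
theorem one_div_den_mem_of_rootClosed (M : AddSubmonoid ℚ) (hM : IsPuiseuxMonoid M)
    (hrc : IsRootClosedPM M) (h1 : (1 : ℚ) ∈ M)
    (r : ℚ) (hr : r ∈ M) (hr0 : r ≠ 0) :
    (1 : ℚ) / (r.den : ℚ) ∈ M := by
  have hd : (r.den : ℚ) ≠ 0 := by exact_mod_cast r.den_nz
  have hcop : IsCoprime r.num (r.den : ℤ) := by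
    rw [Int.isCoprime_iff_gcd_eq_one]
    exact r.reduced
  obtain ⟨u, v, huv⟩ := hcop
  have key : (1 : ℚ) / r.den = u * r + v := by
    have h : (u : ℚ) * r.num + v * r.den = 1 := by exact_mod_cast huv
    rw [div_eq_iff hd, add_mul, mul_assoc, Rat.mul_den_eq_num, h]
  have hsplit (z : ℤ) : (z : ℚ) = (z.toNat : ℚ) - ((-z).toNat : ℚ) := by
    exact_mod_cast (Int.toNat_sub_toNat_neg z).symm
  refine hrc _ ⟨u.toNat • r + v.toNat • 1, ?_, (-u).toNat • r + (-v).toNat • 1, ?_, ?_⟩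
    ⟨r.den, r.den_pos, ?_⟩
  · exact M.add_mem (M.nsmul_mem hr _) (M.nsmul_mem h1 _)
  · exact M.add_mem (M.nsmul_mem hr _) (M.nsmul_mem h1 _)
  · rw [key, hsplit u, hsplit v]
    simp only [nsmul_eq_mul]
    ring
  · rwa [mul_one_div_cancel hd]
end

section
/- Let F be a field and M a root-closed Puiseux monoid. Then the Puiseux algebra F[M] is an unrestricted unique factorization domain (U-UFD): whenever g_1⋯g_k = h_1⋯h_ℓ with all g_i and h_j irreducible in F[M], then k = ℓ and there is a permutation σ of {1,…,k} such that g_i and h_{σ(i)} are associates for every i. -/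
/-- Two elements of a root-closed Puiseux monoid are natural multiples of a common element. -/
theorem IsRootClosedPM.exists_common_divisor {M : AddSubmonoid ℚ} (hM : IsPuiseuxMonoid M)
    (hrc : IsRootClosedPM M) (a b : M) :
    ∃ c : M, (∃ m : ℕ, a = m • c) ∧ ∃ n : ℕ, b = n • c := by
  obtain ⟨a, ha⟩ := a
  obtain ⟨b, hb⟩ := b
  rcases eq_or_ne a 0 with rfl | ha0
  · exact ⟨⟨b, hb⟩, ⟨0, by ext; simp⟩, 1, by simp⟩
  obtain ⟨p, hp⟩ := Int.eq_ofNat_of_zero_le (Rat.num_nonneg.2 (hM a ha))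
  obtain ⟨q, hq⟩ := Int.eq_ofNat_of_zero_le (Rat.num_nonneg.2 (hM b hb))
  have hda : (a.den : ℚ) ≠ 0 := by exact_mod_cast a.den_nz
  have hdb : (b.den : ℚ) ≠ 0 := by exact_mod_cast b.den_nz
  have hpa : a = p / a.den := by
    conv_lhs => rw [← Rat.num_div_den a, hp]
    simp
  have hqb : b = q / b.den := by
    conv_lhs => rw [← Rat.num_div_den b, hq]
    simp
  obtain ⟨k, hk⟩ := Nat.gcd_dvd_left (p * b.den) (q * a.den)
  obtain ⟨l, hl⟩ := Nat.gcd_dvd_right (p * b.den) (q * a.den)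
  have hbez := Nat.gcd_eq_gcd_ab (p * b.den) (q * a.den)
  generalize Nat.gcd (p * b.den) (q * a.den) = g at hk hl hbez
  generalize Nat.gcdA (p * b.den) (q * a.den) = u at hbez
  generalize Nat.gcdB (p * b.den) (q * a.den) = v at hbez
  have hkQ : (p * b.den : ℚ) = g * k := by exact_mod_cast hk
  have hlQ : (q * a.den : ℚ) = g * l := by exact_mod_cast hl
  have hbezQ : (g : ℚ) = p * b.den * u + q * a.den * v := by exact_mod_cast hbez
  generalize (a.den : ℚ) = d at *
  generalize (b.den : ℚ) = e at *
  have hak : a = k * (g / (d * e)) := by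
    rw [hpa]; field_simp; linarith
  have hbl : b = l * (g / (d * e)) := by
    rw [hqb]; field_simp; linarith
  have hguv : g / (d * e) = u * a + v * b := by
    rw [hpa, hqb, hbezQ]; field_simp
  have hcM : g / (d * e) ∈ M := by
    refine hrc _ ⟨u.toNat • a + v.toNat • b, ?_, (-u).toNat • a + (-v).toNat • b, ?_, ?_⟩
      ⟨k, ?_, ?_⟩
    · exact add_mem (nsmul_mem ha _) (nsmul_mem hb _)
    · exact add_mem (nsmul_mem ha _) (nsmul_mem hb _)
    · have hu : (u : ℚ) = u.toNat - (-u).toNat := by exact_mod_cast (Int.toNat_sub_toNat_neg u).symm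
      have hv : (v : ℚ) = v.toNat - (-v).toNat := by exact_mod_cast (Int.toNat_sub_toNat_neg v).symm
      rw [hguv, hu, hv]
      simp only [nsmul_eq_mul]
      ring
    · refine Nat.pos_of_ne_zero fun h0 => ha0 ?_
      rw [hak, h0]; simp
    · rw [← hak]; exact ha
  exact ⟨⟨_, hcM⟩, ⟨k, by ext; simpa using hak⟩, l, by ext; simpa using hbl⟩

/-- Finitely many elements of a root-closed Puiseux monoid are natural multiples of a common
element. -/
theorem IsRootClosedPM.exists_common_divisor_finset {M : AddSubmonoid ℚ} (hM : IsPuiseuxMonoid M)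
    (hrc : IsRootClosedPM M) (S : Finset M) :
    ∃ c : M, ∀ x ∈ S, ∃ n : ℕ, x = n • c := by
  classical
  induction S using Finset.induction_on with
  | empty => exact ⟨0, by simp⟩
  | insert a S _ ih =>
    obtain ⟨c, hc⟩ := ih
    obtain ⟨e, ⟨m, hm⟩, n, hn⟩ := hrc.exists_common_divisor hM a c
    refine ⟨e, fun x hx => ?_⟩
    rcases Finset.mem_insert.1 hx with rfl | hx
    · exact ⟨m, hm⟩
    · obtain ⟨k, hk⟩ := hc x hx
      exact ⟨k * n, by rw [hk, hn, mul_smul]⟩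

/-- An element of a monoid algebra supported on multiples of `c` is a polynomial in `X ^ c`. -/
theorem AddMonoidAlgebra.mem_range_aeval_single {R A : Type*} [CommSemiring R] [AddCommMonoid A]
    {c : A} {x : AddMonoidAlgebra R A} (hx : ∀ a ∈ x.coeff.support, ∃ n : ℕ, a = n • c) :
    ∃ p : Polynomial R, Polynomial.aeval (AddMonoidAlgebra.single c (1 : R)) p = x := by
  change x ∈ (Polynomial.aeval (AddMonoidAlgebra.single c (1 : R))).range
  rw [← AddMonoidAlgebra.sum_coeff_single x]
  refine sum_mem fun a ha => ?_
  obtain ⟨n, rfl⟩ := hx a ha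
  refine ⟨Polynomial.monomial n (x.coeff (n • c)), ?_⟩
  simp [Polynomial.aeval_monomial, AddMonoidAlgebra.single_pow]

/-- The algebra of a root-closed Puiseux monoid over a field is a Bézout ring. -/
theorem IsRootClosedPM.isBezout {F : Type*} [Field F] {M : AddSubmonoid ℚ}
    (hM : IsPuiseuxMonoid M) (hrc : IsRootClosedPM M) : IsBezout (AddMonoidAlgebra F M) := by
  classical
  rw [IsBezout.iff_span_pair_isPrincipal]
  intro x y
  obtain ⟨c, hc⟩ := hrc.exists_common_divisor_finset hM (x.coeff.support ∪ y.coeff.support)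
  obtain ⟨p, rfl⟩ := AddMonoidAlgebra.mem_range_aeval_single
    fun a ha => hc a (Finset.mem_union_left _ ha)
  obtain ⟨q, rfl⟩ := AddMonoidAlgebra.mem_range_aeval_single
    fun a ha => hc a (Finset.mem_union_right _ ha)
  obtain ⟨d, hd⟩ := (IsPrincipalIdealRing.principal (Ideal.span {p, q})).principal
  have h := congrArg
    (Ideal.map (Polynomial.aeval (R := F) (AddMonoidAlgebra.single c (1 : F)))) hd
  rw [Ideal.submodule_span_eq, Ideal.map_span, Ideal.map_span, Set.image_pair,
    Set.image_singleton] at h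
  exact ⟨_, h⟩

/-- If `M` is a root-closed Puiseux monoid and `F` a field, then the Puiseux algebra `F[M]` is
an unrestricted UFD: any two factorizations of an element into irreducibles agree up to order
and associates. -/
theorem rootClosed_puiseux_algebra_UUFD (F : Type*) [Field F]
    (M : AddSubmonoid ℚ) (hM : IsPuiseuxMonoid M) (hrc : IsRootClosedPM M)
    (s t : Multiset (AddMonoidAlgebra F M))
    (hs : ∀ g ∈ s, Irreducible g) (ht : ∀ g ∈ t, Irreducible g)
    (h : s.prod = t.prod) :
    Multiset.Rel Associated s t := by
  have : IsBezout (AddMonoidAlgebra F M) := hrc.isBezout hM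
  exact prime_factors_unique (fun g hg => (hs g hg).prime) (fun g hg => (ht g hg).prime)
    (h ▸ Associated.refl _)
end
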